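/- arXiv:2401.00558 — 6 statements merged into one kernel-verified Lean document; each statement's English description precedes it below -/
import Mathlib

section
/- Let κ and k be locally integrable functions on (0,∞) satisfying the Sonin condition (κ * k)(x) = 1 for all x > 0, and let f : [0,∞) → ℝ be continuous. Then for every x > 0, the general fractional derivative of the general fractional integral of f returns f: d/dx ∫₀ˣ k(x−t) (∫₀ᵗ κ(t−s) f(s) ds) dt = f(x). -/
open MeasureTheory Real

open Set Filter Topology ENNReal Pointwise in
/-- If the convolution of two nonnegative functions is finite almost everywhere and the first
function is not almost everywhere zero, then the second one has finite integral near `0`. -/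
lemma exists_nhds_zero_setLIntegral_lt_top {a b : ℝ → ℝ≥0∞} (ha : AEMeasurable a)
    (hb : AEMeasurable b) (ha0 : ¬ a =ᵐ[volume] 0)
    (hfin : ∀ x, ∫⁻ ξ, a (x - ξ) * b ξ < ∞) :
    ∃ U ∈ 𝓝 (0 : ℝ), ∫⁻ ξ in U, b ξ < ∞ := by
  have hprod : AEMeasurable (fun p : ℝ × ℝ => a (p.1 - p.2) * b p.2)
      ((volume : Measure ℝ).prod volume) :=
    (ha.comp_quasiMeasurePreserving (quasiMeasurePreserving_sub volume volume)).mul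
      hb.comp_snd
  have hF : AEMeasurable (fun x => ∫⁻ ξ, a (x - ξ) * b ξ) := hprod.lintegral_prod_right'
  obtain ⟨n, hn⟩ : ∃ n : ℕ, volume {x | ∫⁻ ξ, a (x - ξ) * b ξ ≤ n ∧ (n : ℝ≥0∞)⁻¹ ≤ a x} ≠ 0 := by
    by_contra! h
    refine ha0 (measure_mono_null ?_ (measure_iUnion_null h))
    intro x hx
    have hx' : a x ≠ 0 := hx
    obtain ⟨n, hn⟩ := ENNReal.exists_nat_gt (hfin x).ne
    obtain ⟨m, hm⟩ := ENNReal.exists_inv_nat_lt hx'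
    refine mem_iUnion.2 ⟨max n m, hn.le.trans ?_, le_trans ?_ hm.le⟩
    · exact_mod_cast le_max_left n m
    · exact ENNReal.inv_le_inv.2 (by exact_mod_cast le_max_right n m)
  have hnull : NullMeasurableSet
      {x | ∫⁻ ξ, a (x - ξ) * b ξ ≤ n ∧ (n : ℝ≥0∞)⁻¹ ≤ a x} :=
    (nullMeasurableSet_le hF aemeasurable_const).inter
      (nullMeasurableSet_le aemeasurable_const ha)
  obtain ⟨B, hBsub, hBm, hBae⟩ := hnull.exists_measurable_subset_ae_eq
  rw [← measure_congr hBae] at hn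
  obtain ⟨K, hKB, hK, hKpos⟩ := hBm.exists_lt_isCompact (pos_iff_ne_zero.2 hn)
  have hKtop : volume K ≠ ∞ := hK.measure_lt_top.ne
  have hhalf : volume K / 2 ≠ 0 := (ENNReal.half_pos hKpos.ne').ne'
  have hev := eventually_nhds_zero_measure_vadd_sdiff_lt (μ := (volume : Measure ℝ)) hK
    hK.isClosed hhalf
  obtain ⟨U, hUsub, hUo, hU0⟩ := mem_nhds_iff.1 hev
  refine ⟨U, hUo.mem_nhds hU0, ?_⟩
  have hlow : ∀ ξ ∈ U, (n : ℝ≥0∞)⁻¹ * (volume K / 2) ≤ ∫⁻ x in K, a (x - ξ) := by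
    intro ξ hξ
    have h1 : volume ((ξ +ᵥ K) \ K) < volume K / 2 := hUsub hξ
    have hmK : MeasurableSet (ξ +ᵥ K) := (hK.vadd ξ).measurableSet
    have h2 : volume K / 2 ≤ volume (K ∩ (ξ +ᵥ K)) := by
      have h3 : volume (ξ +ᵥ K) = volume K := measure_vadd _ _ _
      have h4 := measure_inter_add_sdiff (μ := volume) (ξ +ᵥ K) hK.measurableSet
      rw [h3] at h4
      rw [inter_comm]
      by_contra! hlt
      have := ENNReal.add_lt_add hlt h1
      rw [h4, ENNReal.add_halves] at this
      exact lt_irrefl _ this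
    calc (n : ℝ≥0∞)⁻¹ * (volume K / 2) ≤ (n : ℝ≥0∞)⁻¹ * volume (K ∩ (ξ +ᵥ K)) := by gcongr
      _ = ∫⁻ x in K ∩ (ξ +ᵥ K), (n : ℝ≥0∞)⁻¹ := by rw [setLIntegral_const]
      _ ≤ ∫⁻ x in K ∩ (ξ +ᵥ K), a (x - ξ) := by
          refine setLIntegral_mono' (hK.measurableSet.inter hmK) fun x hx => ?_
          obtain ⟨z, hz, hzx⟩ := hx.2
          have : x - ξ = z := by simp [← hzx]
          rw [this]
          exact (hBsub (hKB hz)).2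
      _ ≤ ∫⁻ x in K, a (x - ξ) := lintegral_mono_set inter_subset_left
  have hc0 : (n : ℝ≥0∞)⁻¹ * (volume K / 2) ≠ 0 := mul_ne_zero (by simp) hhalf
  have hmain : (n : ℝ≥0∞)⁻¹ * (volume K / 2) * ∫⁻ ξ in U, b ξ ≤ n * volume K := by
    have hswap : AEMeasurable (Function.uncurry fun x ξ : ℝ => a (x - ξ) * b ξ)
        ((volume.restrict K).prod volume) :=
      hprod.mono_ac (Measure.absolutelyContinuous_restrict.prod .rfl)
    calc (n : ℝ≥0∞)⁻¹ * (volume K / 2) * ∫⁻ ξ in U, b ξ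
        = ∫⁻ ξ in U, (n : ℝ≥0∞)⁻¹ * (volume K / 2) * b ξ :=
          (lintegral_const_mul'' _ hb.restrict).symm
      _ ≤ ∫⁻ ξ in U, (∫⁻ x in K, a (x - ξ)) * b ξ :=
          setLIntegral_mono' hUo.measurableSet fun ξ hξ => by gcongr; exact hlow ξ hξ
      _ ≤ ∫⁻ ξ, (∫⁻ x in K, a (x - ξ)) * b ξ := setLIntegral_le_lintegral _ _
      _ = ∫⁻ ξ, ∫⁻ x in K, a (x - ξ) * b ξ := by
          refine lintegral_congr fun ξ => (lintegral_mul_const'' _ ?_).symm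
          exact (ha.comp_quasiMeasurePreserving
            (measurePreserving_sub_right volume ξ).quasiMeasurePreserving).restrict
      _ = ∫⁻ x in K, ∫⁻ ξ, a (x - ξ) * b ξ := (lintegral_lintegral_swap hswap).symm
      _ ≤ ∫⁻ _ in K, (n : ℝ≥0∞) :=
          setLIntegral_mono' hK.measurableSet fun x hx => (hBsub (hKB hx)).1
      _ = n * volume K := setLIntegral_const _ _
  refine lt_top_iff_ne_top.2 fun h => ?_
  rw [h, ENNReal.mul_top hc0, top_le_iff] at hmain
  exact ENNReal.mul_ne_top (ENNReal.natCast_ne_top n) hKtop hmain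

open Set Filter Topology ENNReal in
/-- The second kernel of a Sonin pair is integrable up to the origin. -/
lemma integrableOn_Ioo_of_sonin {κ k : ℝ → ℝ} (hκ : LocallyIntegrableOn κ (Ioi 0))
    (hk : LocallyIntegrableOn k (Ioi 0))
    (hSonin : ∀ x > 0, ∫ ξ in (0 : ℝ)..x, κ (x - ξ) * k ξ = 1) (y : ℝ) :
    IntegrableOn k (Ioo 0 y) := by
  have hmeas : ∀ {g : ℝ → ℝ}, LocallyIntegrableOn g (Ioi 0) →
      AEMeasurable (fun x => ‖(Ioi (0 : ℝ)).indicator g x‖ₑ) := fun hg =>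
    ((aestronglyMeasurable_indicator_iff measurableSet_Ioi).2 hg.aestronglyMeasurable).enorm
  have hκ0 : ¬ (fun x => ‖(Ioi (0 : ℝ)).indicator κ x‖ₑ) =ᵐ[volume] 0 := by
    intro h
    have h1 := (Measure.measurePreserving_sub_left volume (1 : ℝ)).quasiMeasurePreserving.ae h
    have h2 : ∫ ξ in (0 : ℝ)..1, κ (1 - ξ) * k ξ = 0 := by
      rw [intervalIntegral.integral_of_le zero_le_one, integral_Ioc_eq_integral_Ioo]
      refine integral_eq_zero_of_ae ?_
      filter_upwards [ae_restrict_of_ae h1, ae_restrict_mem measurableSet_Ioo] with ξ h3 h4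
      have h5 : κ (1 - ξ) = 0 := by
        have : (1 - ξ) ∈ Ioi (0 : ℝ) := sub_pos.2 h4.2
        simpa [indicator_of_mem this] using h3
      simp [h5]
    exact zero_ne_one (h2.symm.trans (hSonin 1 one_pos))
  have hfin : ∀ x : ℝ, ∫⁻ ξ, ‖(Ioi (0 : ℝ)).indicator κ (x - ξ)‖ₑ *
      ‖(Ioi (0 : ℝ)).indicator k ξ‖ₑ < ∞ := by
    intro x
    have heq : ∀ ξ, ‖(Ioi (0 : ℝ)).indicator κ (x - ξ)‖ₑ * ‖(Ioi (0 : ℝ)).indicator k ξ‖ₑ =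
        (Ioo 0 x).indicator (fun ξ => ‖κ (x - ξ) * k ξ‖ₑ) ξ := by
      intro ξ
      by_cases h1 : 0 < ξ <;> by_cases h2 : ξ < x <;> simp [indicator, h1, h2, enorm_mul]
    simp_rw [heq]
    rw [lintegral_indicator measurableSet_Ioo]
    rcases le_or_gt x 0 with hx | hx
    · simp [Ioo_eq_empty_of_le hx]
    · have hint : IntervalIntegrable (fun ξ => κ (x - ξ) * k ξ) volume 0 x := by
        by_contra h
        exact zero_ne_one ((intervalIntegral.integral_undef h).symm.trans (hSonin x hx))
      rw [intervalIntegrable_iff_integrableOn_Ioo_of_le hx.le] at hint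
      exact hint.2
  obtain ⟨U, hU, hUfin⟩ :=
    exists_nhds_zero_setLIntegral_lt_top (hmeas hκ) (hmeas hk) hκ0 hfin
  obtain ⟨δ, hδ, hδU⟩ := Metric.mem_nhds_iff.1 hU
  have hnear : IntegrableOn k (Ioo 0 δ) := by
    refine ⟨hk.aestronglyMeasurable.mono_set Ioo_subset_Ioi_self, lt_of_le_of_lt ?_ hUfin⟩
    calc ∫⁻ ξ in Ioo 0 δ, ‖k ξ‖ₑ = ∫⁻ ξ in Ioo 0 δ, ‖(Ioi (0 : ℝ)).indicator k ξ‖ₑ :=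
          setLIntegral_congr_fun measurableSet_Ioo fun ξ hξ => by
            simp [indicator_of_mem (show ξ ∈ Ioi (0 : ℝ) from hξ.1)]
      _ ≤ _ := lintegral_mono_set fun ξ hξ => hδU (by
          rw [Metric.mem_ball, dist_zero_right, norm_eq_abs, abs_of_pos hξ.1]; exact hξ.2)
  have hfar : IntegrableOn k (Icc δ y) :=
    hk.integrableOn_compact_subset (fun _ h => lt_of_lt_of_le hδ h.1) isCompact_Icc
  refine (hnear.union hfar).mono_set fun ξ hξ => ?_
  rcases lt_or_ge ξ δ with h | h
  · exact Or.inl ⟨hξ.1, h⟩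
  · exact Or.inr ⟨h, hξ.2.le⟩

open Set Filter Topology in
/-- Applying the integrals with the two kernels of a Sonin pair successively amounts to
ordinary integration. -/
lemma sonin_integral_integral {κ k f : ℝ → ℝ} {y : ℝ} (hy : 0 < y)
    (hκ : IntegrableOn κ (Ioo 0 y)) (hk : IntegrableOn k (Ioo 0 y))
    (hSonin : ∀ x > 0, ∫ ξ in (0 : ℝ)..x, k (x - ξ) * κ ξ = 1)
    (hf : ContinuousOn f (Ici 0)) :
    ∫ t in (0 : ℝ)..y, k (y - t) * ∫ s in (0 : ℝ)..t, κ (t - s) * f s =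
      ∫ s in (0 : ℝ)..y, f s := by
  set κ' := (Ioo 0 y).indicator κ with hκ'
  set k' := (Ioo 0 y).indicator k with hk'
  set f' := (Ioo 0 y).indicator f with hf'
  have hκi : Integrable κ' := hκ.integrable_indicator measurableSet_Ioo
  have hki : Integrable k' := hk.integrable_indicator measurableSet_Ioo
  have hfy : ContinuousOn f (Icc 0 y) := hf.mono Icc_subset_Ici_self
  have hfm : AEStronglyMeasurable f' :=
    (aestronglyMeasurable_indicator_iff measurableSet_Ioo).2
      ((hfy.mono Ioo_subset_Icc_self).aestronglyMeasurable measurableSet_Ioo)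
  obtain ⟨M, hM⟩ := isCompact_Icc.exists_bound_of_continuousOn hfy
  have hfM : ∀ s, ‖f' s‖ ≤ M := by
    intro s
    by_cases hs : s ∈ Ioo 0 y
    · rw [hf', indicator_of_mem hs]
      exact hM s (Ioo_subset_Icc_self hs)
    · rw [hf', indicator_of_notMem hs, norm_zero]
      exact (norm_nonneg _).trans (hM 0 ⟨le_rfl, hy.le⟩)
  have hG : Integrable (Function.uncurry fun s t : ℝ => k' (y - t) * κ' (t - s) * f' s)
      ((volume : Measure ℝ).prod volume) := by
    have h1 := (hki.comp_sub_left y).convolution_integrand (ContinuousLinearMap.mul ℝ ℝ)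
      hκi.comp_neg
    refine (h1.mul_bdd (c := M) (g := fun p => f' p.1) hfm.comp_fst
      (Eventually.of_forall fun p => hfM p.1)).congr (Eventually.of_forall fun p => ?_)
    simp [Function.uncurry]
  have hinner : ∀ t, ∫ s, k' (y - t) * κ' (t - s) * f' s =
      (Ioo 0 y).indicator (fun t => k (y - t) * ∫ s in (0 : ℝ)..t, κ (t - s) * f s) t := by
    intro t
    by_cases ht : t ∈ Ioo 0 y
    · rw [indicator_of_mem ht, intervalIntegral.integral_of_le ht.1.le,
        integral_Ioc_eq_integral_Ioo, ← integral_indicator measurableSet_Ioo,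
        ← integral_const_mul]
      refine integral_congr_ae (Eventually.of_forall fun s => ?_)
      have h1 : k' (y - t) = k (y - t) :=
        indicator_of_mem (mem_Ioo.2 ⟨by linarith [ht.2], by linarith [ht.1]⟩) _
      by_cases hs : s ∈ Ioo 0 t
      · have h2 : κ' (t - s) = κ (t - s) :=
          indicator_of_mem (mem_Ioo.2 ⟨by linarith [hs.2], by linarith [hs.1, ht.2]⟩) _
        have h3 : f' s = f s := indicator_of_mem (mem_Ioo.2 ⟨hs.1, hs.2.trans ht.2⟩) _
        simp only [h1, h2, h3, indicator_of_mem hs]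
        ring
      · simp only [indicator_of_notMem hs, mul_zero]
        rcases not_and_or.1 hs with h | h
        · rw [hf', indicator_of_notMem fun h' => h h'.1, mul_zero]
        · rw [hκ', indicator_of_notMem fun h' => h (by linarith [h'.1]), mul_zero, zero_mul]
    · rw [indicator_of_notMem ht]
      have h1 : k' (y - t) = 0 :=
        indicator_of_notMem (fun h => ht ⟨by linarith [h.2], by linarith [h.1]⟩) _
      simp [h1]
  have houter : ∀ s, ∫ t, k' (y - t) * κ' (t - s) * f' s = f' s := by
    intro s
    rw [integral_mul_const]
    by_cases hs : s ∈ Ioo 0 y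
    · suffices h : ∫ t, k' (y - t) * κ' (t - s) = 1 by rw [h, one_mul]
      rw [← hSonin (y - s) (sub_pos.2 hs.2),
        intervalIntegral.integral_of_le (sub_pos.2 hs.2).le, integral_Ioc_eq_integral_Ioo,
        ← integral_indicator measurableSet_Ioo,
        ← integral_add_right_eq_self (fun t => k' (y - t) * κ' (t - s)) s]
      refine integral_congr_ae (Eventually.of_forall fun u => ?_)
      by_cases hu : u ∈ Ioo 0 (y - s)
      · have h1 : k' (y - (u + s)) = k (y - (u + s)) :=
          indicator_of_mem (mem_Ioo.2 ⟨by linarith [hu.2], by linarith [hu.1, hs.1]⟩) _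
        have h2 : κ' u = κ u := indicator_of_mem (mem_Ioo.2 ⟨hu.1, by linarith [hu.2, hs.1]⟩) _
        simp only [indicator_of_mem hu, add_sub_cancel_right, h1, h2]
        congr 2
        ring
      · simp only [indicator_of_notMem hu, add_sub_cancel_right]
        rcases not_and_or.1 hu with h | h
        · rw [hκ', indicator_of_notMem fun h' => h h'.1, mul_zero]
        · rw [hk', indicator_of_notMem fun h' => h (by linarith [h'.1]), zero_mul]
    · rw [hf', indicator_of_notMem hs, mul_zero]
  have hswap := integral_integral_swap hG
  simp_rw [hinner, houter] at hswap
  rw [hf', integral_indicator measurableSet_Ioo, integral_indicator measurableSet_Ioo,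
    ← integral_Ioc_eq_integral_Ioo, ← integral_Ioc_eq_integral_Ioo,
    ← intervalIntegral.integral_of_le hy.le, ← intervalIntegral.integral_of_le hy.le] at hswap
  exact hswap.symm

/-- For a pair of Sonin kernels `(κ, k)`, the general fractional derivative with kernel `k`
is a left-inverse of the general fractional integral with kernel `κ` on continuous functions. -/
theorem gfd_left_inverse_gfi (κ k f : ℝ → ℝ)
    (hκ : LocallyIntegrableOn κ (Set.Ioi 0))
    (hk : LocallyIntegrableOn k (Set.Ioi 0))
    (hSonin : ∀ x > 0, ∫ ξ in (0:ℝ)..x, κ (x - ξ) * k ξ = 1)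
    (hf : ContinuousOn f (Set.Ici 0)) :
    ∀ x > 0, HasDerivAt
      (fun y => ∫ t in (0:ℝ)..y, k (y - t) * ∫ s in (0:ℝ)..t, κ (t - s) * f s) (f x) x := by
  have hSonin' : ∀ x > 0, ∫ ξ in (0:ℝ)..x, k (x - ξ) * κ ξ = 1 := by
    intro x hx
    rw [← hSonin x hx]
    have h := intervalIntegral.integral_comp_sub_left (a := 0) (b := x)
      (fun ξ => κ (x - ξ) * k ξ) x
    simp only [sub_sub_cancel, sub_self, sub_zero] at h
    simpa only [mul_comm] using h
  intro x hx
  have hderiv : HasDerivAt (fun y => ∫ s in (0:ℝ)..y, f s) (f x) x := by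
    refine intervalIntegral.integral_hasDerivAt_right ?_ ?_
      (hf.continuousAt (Ici_mem_nhds hx))
    · refine (hf.mono ?_).intervalIntegrable
      rw [Set.uIcc_of_le hx.le]
      exact Set.Icc_subset_Ici_self
    · exact (hf.mono Set.Ioi_subset_Ici_self).stronglyMeasurableAtFilter isOpen_Ioi x hx
  refine hderiv.congr_of_eventuallyEq ?_
  filter_upwards [Ioi_mem_nhds hx] with y hy
  exact sonin_integral_integral hy (integrableOn_Ioo_of_sonin hk hκ hSonin' y)
    (integrableOn_Ioo_of_sonin hκ hk hSonin y) hSonin' hf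
end

section
/- Let κ₁ and k₁ be locally integrable functions on (0,∞) with (κ₁ * k₁)(x) = 1 for all x > 0, and let f be a function of the form f(x) = x^p f₁(x) with p > 0 and f₁ continuous on [0,∞), not identically zero. Let (aₙ)ₙ≥0 and (bₙ)ₙ≥0 be real sequences such that the power series Σ aₙ zⁿ and Σ bₙ zⁿ have positive radius of convergence, and suppose the convolution series Σₙ₌₁^∞ aₙ f^{<n>}(x) and Σₙ₌₁^∞ bₙ f^{<n>}(x) converge locally uniformly on (0,∞). Define κ(x) = a₀ κ₁(x) + ∫₀ˣ κ₁(x−t) (Σₙ₌₁^∞ aₙ f^{<n>}(t)) dt with a₀ ≠ 0, and k(x) = b₀ k₁(x) + ∫₀ˣ k₁(x−t) (Σₙ₌₁^∞ bₙ f^{<n>}(t)) dt. Then (κ * k)(x) = 1 for all x > 0 if and only if a₀ b₀ = 1 and Σ_{m=0}^n a_m b_{n−m} = 0 for every n ≥ 1. -/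
open MeasureTheory Real

/-- The Laplace convolution of two functions on `(0,∞)`. -/
noncomputable def lconv (f g : ℝ → ℝ) : ℝ → ℝ := fun x => ∫ t in (0:ℝ)..x, f (x - t) * g t

/-- Convolution powers: `f^{<0>} = 1`, `f^{<1>} = f`, `f^{<n+1>} = f * f^{<n>}`. -/
noncomputable def convPow (f : ℝ → ℝ) : ℕ → ℝ → ℝ
  | 0 => fun _ => 1
  | 1 => f
  | (n + 2) => lconv f (convPow f (n + 1))

section

open Set Filter Topology
open scoped Convolution Pointwise

/-- A function on `(0,T)` all of whose integrals over `(0,x)` vanish is zero almost everywhere. -/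
theorem ae_eq_zero_of_intervalIntegral_eq_zero {g : ℝ → ℝ} {T : ℝ}
    (hg : IntegrableOn g (Ioo 0 T)) (h : ∀ x ∈ Ioo 0 T, ∫ t in (0:ℝ)..x, g t = 0) :
    ∀ᵐ x, x ∈ Ioo 0 T → g x = 0 := by
  rcases le_or_gt T 0 with hT | hT
  · simp [Ioo_eq_empty_of_le hT]
  have hi : IntervalIntegrable g volume 0 T :=
    (intervalIntegrable_iff_integrableOn_Ioo_of_le hT.le).2 hg
  filter_upwards [hi.ae_hasDerivAt_integral] with x hx hxT
  have hxI : x ∈ uIcc 0 T := by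
    rw [uIcc_of_le hT.le]; exact Ioo_subset_Icc_self hxT
  have hd := hx hxI 0 left_mem_uIcc
  have hz : (fun x => ∫ t in (0:ℝ)..x, g t) =ᶠ[𝓝 x] fun _ => 0 := by
    filter_upwards [isOpen_Ioo.mem_nhds hxT] with y hy using h y hy
  exact hd.unique ((hasDerivAt_const x (0:ℝ)).congr_of_eventuallyEq hz)

/-- Lerch's theorem in bounded form: if the exponential moments `∫₀ᵀ e^{n(T-t)} g(t) dt` stay
bounded as `n → ∞`, then `g` vanishes almost everywhere on `(0,T)`. -/
theorem ae_eq_zero_of_exp_moments_bounded {g : ℝ → ℝ} {T C : ℝ}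
    (hg : IntegrableOn g (Ioo 0 T))
    (h : ∀ n : ℕ, |∫ t in Ioo 0 T, exp (n * (T - t)) * g t| ≤ C) :
    ∀ᵐ x, x ∈ Ioo 0 T → g x = 0 := by
  refine ae_eq_zero_of_intervalIntegral_eq_zero hg fun τ hτ => ?_
  set ν := volume.restrict (Ioo (0:ℝ) T)
  -- the expansion of `exp (-e^{n(τ-t)})` integrated termwise
  have hseries : ∀ n : ℕ, HasSum
      (fun k : ℕ => (-1) ^ k / (k.factorial : ℝ) * exp (-(k * n * (T - τ))) *
        ∫ t in Ioo 0 T, exp (((k * n : ℕ) : ℝ) * (T - t)) * g t)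
      (∫ t in Ioo 0 T, exp (-exp (n * (τ - t))) * g t) := by
    intro n
    have hmeas : ∀ k : ℕ, AEStronglyMeasurable
        (fun t => (-exp (n * (τ - t))) ^ k / (k.factorial : ℝ) * g t) ν := fun k =>
      (Continuous.aestronglyMeasurable (by fun_prop)).mul hg.aestronglyMeasurable
    have hsum : Summable fun k : ℕ => (exp (n * τ)) ^ k / (k.factorial : ℝ) :=
      Real.summable_pow_div_factorial _
    have key := hasSum_integral_of_dominated_convergence (μ := ν)
      (F := fun (k : ℕ) t => (-exp (n * (τ - t))) ^ k / (k.factorial : ℝ) * g t)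
      (f := fun t => exp (-exp (n * (τ - t))) * g t)
      (fun k t => (exp (n * τ)) ^ k / (k.factorial : ℝ) * |g t|) hmeas
      (fun k => by
        filter_upwards [ae_restrict_mem measurableSet_Ioo] with t ht
        rw [norm_mul, norm_div, norm_pow, norm_neg, Real.norm_eq_abs, abs_exp,
          Real.norm_eq_abs (k.factorial : ℝ), Nat.abs_cast, Real.norm_eq_abs (g t)]
        gcongr
        linarith [ht.1])
      (Eventually.of_forall fun t => hsum.mul_right _)
      (by simp_rw [tsum_mul_right]; exact (Integrable.abs hg).const_mul _)
      (Eventually.of_forall fun t => by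
        have := NormedSpace.expSeries_div_hasSum_exp (𝔸 := ℝ) (-exp (n * (τ - t)))
        rw [← Real.exp_eq_exp_ℝ] at this
        exact this.mul_right (g t))
    refine key.congr_fun fun k => ?_
    rw [← integral_const_mul]
    refine integral_congr_ae (Eventually.of_forall fun t => ?_)
    simp only
    rw [neg_pow (exp _), ← exp_nat_mul, ← mul_assoc, mul_assoc ((-1) ^ k / (k.factorial : ℝ)),
      ← exp_add]
    push_cast
    ring_nf
  have hbound : ∀ n : ℕ, |(∫ t in Ioo 0 T, exp (-exp (n * (τ - t))) * g t) - ∫ t in Ioo 0 T, g t|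
      ≤ C * (exp (exp (-(n * (T - τ)))) - 1) := by
    intro n
    have h1 := (hasSum_nat_add_iff' 1).2 (hseries n)
    have h2 : HasSum (fun k : ℕ => C * (exp (-(n * (T - τ))) ^ (k + 1) / ((k + 1).factorial : ℝ)))
        (C * (exp (exp (-(n * (T - τ)))) - 1)) := by
      have := NormedSpace.expSeries_div_hasSum_exp (𝔸 := ℝ) (exp (-(n * (T - τ))))
      rw [← Real.exp_eq_exp_ℝ] at this
      simpa using ((hasSum_nat_add_iff' 1).2 this).mul_left C
    have h3 := tsum_of_norm_bounded h2 (f := fun k : ℕ =>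
      (-1) ^ (k + 1) / ((k + 1).factorial : ℝ) * exp (-((k + 1 : ℕ) * n * (T - τ))) *
        ∫ t in Ioo 0 T, exp ((((k + 1) * n : ℕ) : ℝ) * (T - t)) * g t) (fun k => by
          rw [norm_mul, norm_mul, norm_div, norm_pow, norm_neg, norm_one, one_pow,
            Real.norm_eq_abs, Nat.abs_cast, Real.norm_eq_abs, abs_exp, ← exp_nat_mul, mul_comm C]
          calc _ ≤ 1 / ((k + 1).factorial : ℝ) * exp (-((k + 1 : ℕ) * n * (T - τ))) * C := by
                gcongr
                exact h _
            _ = _ := by ring_nf)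
    rw [h1.tsum_eq] at h3
    simpa using h3
  have hlim0 : Tendsto (fun n : ℕ => C * (exp (exp (-(n * (T - τ)))) - 1)) atTop (𝓝 0) := by
    have h1 : Tendsto (fun n : ℕ => (n : ℝ) * (T - τ)) atTop atTop :=
      tendsto_natCast_atTop_atTop.atTop_mul_const (by linarith [hτ.2])
    have h2 := (tendsto_exp_neg_atTop_nhds_zero.comp h1)
    have h3 := (continuous_exp.tendsto 0).comp h2
    simpa using (h3.sub_const 1).const_mul C
  have hlim1 : Tendsto (fun n : ℕ => (∫ t in Ioo 0 T, exp (-exp (n * (τ - t))) * g t)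
      - ∫ t in Ioo 0 T, g t) atTop (𝓝 0) :=
    squeeze_zero_norm hbound hlim0
  have hlim2 : Tendsto (fun n : ℕ => ∫ t in Ioo 0 T, exp (-exp (n * (τ - t))) * g t) atTop
      (𝓝 (∫ t in Ioo 0 T, (Ioi τ).indicator g t)) := by
    refine tendsto_integral_of_dominated_convergence (fun t => |g t|)
      (fun n => (Continuous.aestronglyMeasurable (by fun_prop)).mul hg.aestronglyMeasurable)
      (Integrable.abs hg) (fun n => Eventually.of_forall fun t => ?_) ?_
    · rw [norm_mul, Real.norm_eq_abs, abs_exp, Real.norm_eq_abs]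
      refine mul_le_of_le_one_left (abs_nonneg _) (exp_le_one_iff.2 ?_)
      linarith [exp_pos (n * (τ - t))]
    · have hne : ∀ᵐ t ∂ν, t ≠ τ := Measure.ae_ne _ _
      filter_upwards [hne] with t ht
      rcases lt_or_gt_of_ne ht with hlt | hgt
      · rw [indicator_of_notMem (by simpa using hlt.le)]
        have h1 : Tendsto (fun n : ℕ => (n : ℝ) * (τ - t)) atTop atTop :=
          tendsto_natCast_atTop_atTop.atTop_mul_const (by linarith)
        have h2 := tendsto_exp_neg_atTop_nhds_zero.comp (tendsto_exp_atTop.comp h1)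
        simpa using h2.mul_const (g t)
      · rw [indicator_of_mem (by simpa using hgt)]
        have h1 : Tendsto (fun n : ℕ => (n : ℝ) * (t - τ)) atTop atTop :=
          tendsto_natCast_atTop_atTop.atTop_mul_const (by linarith)
        have h2 := (continuous_exp.tendsto _).comp (tendsto_exp_neg_atTop_nhds_zero.comp h1).neg
        have h3 := h2.mul_const (g t)
        simp only [neg_zero, exp_zero, one_mul] at h3
        refine h3.congr fun n => ?_
        simp only [Function.comp]
        ring_nf
  have hlim3 := tendsto_nhds_unique hlim1 (hlim2.sub_const _)
  rw [setIntegral_indicator measurableSet_Ioi] at hlim3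
  have hsplit : ∫ t in Ioo 0 T, g t =
      (∫ t in Ioc 0 τ, g t) + ∫ t in Ioo 0 T ∩ Ioi τ, g t := by
    have hset : Ioo 0 T = Ioc 0 τ ∪ Ioo 0 T ∩ Ioi τ := by
      ext t
      simp only [mem_Ioo, mem_union, mem_Ioc, mem_inter_iff, mem_Ioi]
      constructor
      · intro ht
        rcases le_or_gt t τ with h | h
        · exact Or.inl ⟨ht.1, h⟩
        · exact Or.inr ⟨ht, h⟩
      · rintro (ht | ht)
        · exact ⟨ht.1, ht.2.trans_lt hτ.2⟩
        · exact ht.1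
    conv_lhs => rw [hset]
    refine setIntegral_union ?_ (measurableSet_Ioo.inter measurableSet_Ioi)
      (hg.mono_set fun t ht => ⟨ht.1, ht.2.trans_lt hτ.2⟩) (hg.mono_set inter_subset_left)
    rw [Set.disjoint_left]
    exact fun t ht ht' => absurd ht'.2 (not_lt.2 ht.2)
  rw [intervalIntegral.integral_of_le hτ.1.le]
  linarith

/-- Local integrability on `[0,∞)`. -/
def LocInt (u : ℝ → ℝ) : Prop := ∀ X : ℝ, IntegrableOn u (Ioo 0 X)

/-- Measurability on `(0,∞)` together with boundedness on every interval `(0,X)`. -/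
def LocBdd (u : ℝ → ℝ) : Prop :=
  AEStronglyMeasurable u (volume.restrict (Ioi 0)) ∧ ∀ X : ℝ, ∃ C, ∀ t ∈ Ioo 0 X, |u t| ≤ C

theorem LocBdd.locInt {u : ℝ → ℝ} (hu : LocBdd u) : LocInt u := by
  intro X
  obtain ⟨C, hC⟩ := hu.2 X
  exact IntegrableOn.of_bound (by simp)
    (hu.1.mono_measure (Measure.restrict_mono Ioo_subset_Ioi_self le_rfl)) C
    (by filter_upwards [ae_restrict_mem measurableSet_Ioo] with t ht using hC t ht)

theorem LocInt.aestronglyMeasurable {u : ℝ → ℝ} (hu : LocInt u) :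
    AEStronglyMeasurable u (volume.restrict (Ioi 0)) := by
  have hU : Ioi (0:ℝ) = ⋃ n : ℕ, Ioo (0:ℝ) n := by
    ext t
    simp only [mem_Ioi, mem_iUnion, mem_Ioo]
    exact ⟨fun h => (exists_nat_gt t).imp fun n hn => ⟨h, hn⟩, fun ⟨_, h⟩ => h.1⟩
  rw [hU, aestronglyMeasurable_iUnion_iff]
  exact fun n => (hu n).aestronglyMeasurable

theorem LocInt.integrable_indicator {u : ℝ → ℝ} (hu : LocInt u) (X : ℝ) :
    Integrable ((Ioo 0 X).indicator u) :=
  (hu X).integrable_indicator measurableSet_Ioo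

theorem LocBdd.const_mul {u : ℝ → ℝ} (hu : LocBdd u) (c : ℝ) : LocBdd (fun t => c * u t) := by
  refine ⟨hu.1.const_mul c, fun X => ?_⟩
  obtain ⟨C, hC⟩ := hu.2 X
  exact ⟨|c| * C, fun t ht => by rw [abs_mul]; gcongr; exact hC t ht⟩

theorem lconv_eq_setIntegral (u v : ℝ → ℝ) {x : ℝ} (hx : 0 ≤ x) :
    lconv u v x = ∫ t in Ioo 0 x, u (x - t) * v t := by
  rw [lconv, intervalIntegral.integral_of_le hx, integral_Ioc_eq_integral_Ioo]

theorem lconv_comm (u v : ℝ → ℝ) (x : ℝ) : lconv u v x = lconv v u x := by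
  have := intervalIntegral.integral_comp_sub_left (a := 0) (b := x)
    (fun t => v (x - t) * u t) x
  simp only [sub_sub_cancel, sub_self, sub_zero] at this
  rw [lconv, lconv, ← this]
  simp_rw [mul_comm]

theorem lconv_congr_right {u v w : ℝ → ℝ} {x : ℝ} (hx : 0 ≤ x)
    (h : ∀ᵐ t, t ∈ Ioo 0 x → v t = w t) : lconv u v x = lconv u w x := by
  rw [lconv_eq_setIntegral _ _ hx, lconv_eq_setIntegral _ _ hx]
  refine setIntegral_congr_ae measurableSet_Ioo ?_
  filter_upwards [h] with t ht htx
  rw [ht htx]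

theorem lconv_congr_left {u v w : ℝ → ℝ} {x : ℝ} (hx : 0 ≤ x)
    (h : ∀ᵐ t, t ∈ Ioo 0 x → v t = w t) : lconv v u x = lconv w u x := by
  rw [lconv_comm, lconv_comm w, lconv_congr_right hx h]

theorem lconv_const_mul_right (u v : ℝ → ℝ) (c x : ℝ) :
    lconv u (fun t => c * v t) x = c * lconv u v x := by
  rw [lconv, lconv, ← intervalIntegral.integral_const_mul]
  congr 1; ext t; ring

/-- The Laplace convolution agrees on `(0,X]` with the convolution on `ℝ` of the truncated
functions. -/
theorem lconv_eq_convolution_indicator (u v : ℝ → ℝ) {x : ℝ} {s : Set ℝ}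
    (hx : 0 ≤ x) (hs : Ioo 0 x ⊆ s) (hs0 : s ⊆ Ioi 0) :
    lconv u v x =
      (s.indicator u ⋆[ContinuousLinearMap.mul ℝ ℝ, volume] s.indicator v) x := by
  rw [convolution_mul_swap, lconv_eq_setIntegral _ _ hx, ← integral_indicator measurableSet_Ioo]
  congr 1
  ext t
  by_cases ht : t ∈ Ioo 0 x
  · have h1 : x - t ∈ Ioo 0 x := ⟨by linarith [ht.2], by linarith [ht.1]⟩
    rw [indicator_of_mem ht, indicator_of_mem (hs ht), indicator_of_mem (hs h1)]
  · rw [indicator_of_notMem ht]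
    by_cases h0 : t ∈ s
    · have h1 : x - t ∉ s := fun h1 => ht ⟨hs0 h0, by simpa using hs0 h1⟩
      rw [indicator_of_notMem h1, zero_mul]
    · rw [indicator_of_notMem h0, mul_zero]

theorem LocInt.integrableOn_comp_sub_left {u : ℝ → ℝ} (hu : LocInt u) (x : ℝ) :
    IntegrableOn (fun t => u (x - t)) (Ioo 0 x) := by
  have h := ((hu.integrable_indicator x).comp_sub_left x).integrableOn (s := Ioo 0 x)
  refine h.congr_fun (fun t ht => ?_) measurableSet_Ioo
  exact indicator_of_mem (show x - t ∈ Ioo 0 x from ⟨by linarith [ht.2], by linarith [ht.1]⟩) u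

theorem setIntegral_comp_sub_left_Ioo (u : ℝ → ℝ) {x : ℝ} (hx : 0 ≤ x) :
    ∫ t in Ioo 0 x, u (x - t) = ∫ t in Ioo 0 x, u t := by
  rw [← integral_Ioc_eq_integral_Ioo, ← integral_Ioc_eq_integral_Ioo,
    ← intervalIntegral.integral_of_le hx, ← intervalIntegral.integral_of_le hx,
    intervalIntegral.integral_comp_sub_left, sub_self, sub_zero]

theorem LocInt.intervalIntegrable_lconv {u v : ℝ → ℝ} (hu : LocInt u) (hv : LocBdd v) {x : ℝ}
    (hx : 0 ≤ x) : IntervalIntegrable (fun t => u (x - t) * v t) volume 0 x := by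
  rw [intervalIntegrable_iff_integrableOn_Ioo_of_le hx]
  obtain ⟨C, hC⟩ := hv.2 x
  refine (hu.integrableOn_comp_sub_left x).mul_bdd (c := C)
    (hv.1.mono_measure (Measure.restrict_mono Ioo_subset_Ioi_self le_rfl)) ?_
  filter_upwards [ae_restrict_mem measurableSet_Ioo] with t ht using hC t ht

theorem abs_lconv_le {u v : ℝ → ℝ} (hu : LocInt u) {x C : ℝ} (hx : 0 ≤ x)
    (hC : ∀ t ∈ Ioo 0 x, |v t| ≤ C) : |lconv u v x| ≤ (∫ t in Ioo 0 x, |u t|) * C := by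
  rw [lconv_eq_setIntegral _ _ hx, ← setIntegral_comp_sub_left_Ioo (fun t => |u t|) hx,
    ← integral_mul_const, ← Real.norm_eq_abs]
  have hi : IntegrableOn (fun t => |u (x - t)| * C) (Ioo 0 x) :=
    Integrable.mul_const (Integrable.abs (hu.integrableOn_comp_sub_left x)) C
  refine norm_integral_le_of_norm_le hi ?_
  filter_upwards [ae_restrict_mem measurableSet_Ioo] with t ht
  rw [norm_mul, Real.norm_eq_abs, Real.norm_eq_abs]
  gcongr
  exact hC t ht

theorem LocInt.lconv_locBdd {u v : ℝ → ℝ} (hu : LocInt u) (hv : LocBdd v) : LocBdd (lconv u v) := by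
  constructor
  · have hu' := (aestronglyMeasurable_indicator_iff measurableSet_Ioi).2 hu.aestronglyMeasurable
    have hv' := (aestronglyMeasurable_indicator_iff measurableSet_Ioi).2 hv.1
    have h := (hu'.convolution_integrand (ContinuousLinearMap.mul ℝ ℝ) hv').integral_prod_right'
    refine (h.mono_measure Measure.restrict_le_self).congr ?_
    filter_upwards [ae_restrict_mem measurableSet_Ioi] with x hx
    rw [lconv_eq_convolution_indicator u v (le_of_lt hx) Ioo_subset_Ioi_self le_rfl]
    rfl
  · intro X
    obtain ⟨C, hC⟩ := hv.2 X
    refine ⟨(∫ t in Ioo 0 X, |u t|) * C, fun x hx => ?_⟩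
    have hC0 : 0 ≤ C := (abs_nonneg _).trans (hC x hx)
    refine (abs_lconv_le hu hx.1.le fun t ht => hC t ⟨ht.1, ht.2.trans hx.2⟩).trans ?_
    refine mul_le_mul_of_nonneg_right ?_ hC0
    exact setIntegral_mono_set (Integrable.abs (hu X)) (Eventually.of_forall fun _ => abs_nonneg _)
      (Ioo_subset_Ioo_right hx.2.le).eventuallyLE

theorem lconv_assoc {u v w : ℝ → ℝ} (hu : LocInt u) (hv : LocInt v) (hw : LocBdd w) {x : ℝ}
    (hx : 0 ≤ x) : lconv (lconv u v) w x = lconv u (lconv v w) x := by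
  set L := ContinuousLinearMap.mul ℝ ℝ
  set u' := (Ioo 0 x).indicator u with hu'
  set v' := (Ioo 0 x).indicator v with hv'
  set w' := (Ioo 0 x).indicator w with hw'
  have iu : Integrable u' := hu.integrable_indicator x
  have iv : Integrable v' := hv.integrable_indicator x
  have iw : Integrable w' := hw.locInt.integrable_indicator x
  obtain ⟨C, hC⟩ := hw.2 x
  have bw : ∀ t, ‖w' t‖ ≤ max C 0 := by
    intro t
    by_cases ht : t ∈ Ioo 0 x
    · rw [hw', indicator_of_mem ht]; exact (hC t ht).trans (le_max_left _ _)
    · rw [hw', indicator_of_notMem ht]; simp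
  have hassoc : ((u' ⋆[L, volume] v') ⋆[L, volume] w') x
      = (u' ⋆[L, volume] (v' ⋆[L, volume] w')) x := by
    refine convolution_assoc L L L L (fun a b c => mul_assoc a b c) iu.aestronglyMeasurable
      iv.aestronglyMeasurable iw.aestronglyMeasurable (iu.ae_convolution_exists L iv)
      (iv.norm.ae_convolution_exists _ iw.norm) ?_
    refine BddAbove.convolutionExistsAt (s := univ) _ ?_ MeasurableSet.univ (subset_univ _)
      iu.norm.integrableOn (iv.norm.integrable_convolution _ iw.norm).aestronglyMeasurable
    refine ⟨(∫ t, ‖v' t‖) * max C 0, ?_⟩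
    rintro _ ⟨y, -, rfl⟩
    simp only [convolution_def]
    rw [← integral_mul_const]
    refine norm_integral_le_of_norm_le (iv.norm.mul_const _) (Eventually.of_forall fun t => ?_)
    simp only [ContinuousLinearMap.mul_apply', norm_mul, norm_norm]
    gcongr
    exact bw _
  have hl : lconv (lconv u v) w x = ((u' ⋆[L, volume] v') ⋆[L, volume] w') x := by
    rw [convolution_mul_swap, lconv_eq_setIntegral _ _ hx, ← integral_indicator measurableSet_Ioo]
    congr 1
    ext t
    by_cases ht : t ∈ Ioo 0 x
    · rw [indicator_of_mem ht, hw', indicator_of_mem ht,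
        lconv_eq_convolution_indicator u v (s := Ioo 0 x) (by linarith [ht.2])
          (Ioo_subset_Ioo_right (by linarith [ht.1])) Ioo_subset_Ioi_self]
    · rw [indicator_of_notMem ht, hw', indicator_of_notMem ht, mul_zero]
  have hr : lconv u (lconv v w) x = (u' ⋆[L, volume] (v' ⋆[L, volume] w')) x := by
    rw [lconv_comm, convolution_mul, lconv_eq_setIntegral _ _ hx,
      ← integral_indicator measurableSet_Ioo]
    congr 1
    ext t
    by_cases ht : t ∈ Ioo 0 x
    · rw [indicator_of_mem ht, hu', indicator_of_mem ht, mul_comm,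
        lconv_eq_convolution_indicator v w (s := Ioo 0 x) (by linarith [ht.2])
          (Ioo_subset_Ioo_right (by linarith [ht.1])) Ioo_subset_Ioi_self]
    · rw [indicator_of_notMem ht, hu', indicator_of_notMem ht, zero_mul]
  rw [hl, hr, hassoc]

/-- Titchmarsh's theorem for squares: a locally integrable function whose Laplace convolution with
itself vanishes is zero almost everywhere. -/
theorem ae_eq_zero_of_lconv_self_eq_zero {g : ℝ → ℝ} (hg : LocInt g)
    (h : ∀ᵐ x, 0 < x → lconv g g x = 0) : ∀ᵐ x, 0 < x → g x = 0 := by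
  suffices hT : ∀ T : ℝ, 0 < T → ∀ᵐ x, x ∈ Ioo 0 T → g x = 0 by
    have hall := ae_all_iff.2 fun n : ℕ => hT (n + 1) (by positivity)
    filter_upwards [hall] with x hx hx0
    obtain ⟨n, hn⟩ := exists_nat_gt x
    exact hx n ⟨hx0, by linarith⟩
  intro T hT
  set L := ContinuousLinearMap.mul ℝ ℝ
  set g' := (Ioo 0 (2 * T)).indicator g with hg'
  have ig : Integrable g' := hg.integrable_indicator _
  have hg'0 : ∀ t, t ≤ 0 → g' t = 0 := fun t ht =>
    indicator_of_notMem (fun h => absurd h.1 (not_lt.2 ht)) _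
  have hconv : ∀ᵐ y, y < 2 * T → (g' ⋆[L, volume] g') y = 0 := by
    filter_upwards [h] with y hy hyT
    rcases le_or_gt y 0 with hy0 | hy0
    · rw [convolution_mul]
      refine integral_eq_zero_of_ae (Eventually.of_forall fun t => ?_)
      rcases le_or_gt t 0 with ht | ht
      · simp [hg'0 t ht]
      · simp [hg'0 (y - t) (by linarith)]
    · rw [← hy hy0, lconv_eq_convolution_indicator g g hy0.le (Ioo_subset_Ioo_right hyT.le)
        Ioo_subset_Ioi_self]
  set D := ∫ y, ‖(g' ⋆[L, volume] g') y‖ with hD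
  have iD : Integrable (g' ⋆[L, volume] g') := ig.integrable_convolution L ig
  have hmoment : ∀ n : ℕ, |∫ t, exp (n * (T - t)) * g' t| ≤ √D := by
    intro n
    set e : ℝ → ℝ := fun t => exp (-(n * t)) * g' t with he
    have ie : Integrable e := by
      refine ig.mono ((Continuous.aestronglyMeasurable (by fun_prop)).mul ig.aestronglyMeasurable)
        (Eventually.of_forall fun t => ?_)
      rw [he, norm_mul, Real.norm_eq_abs, abs_exp]
      rcases le_or_gt t 0 with ht | ht
      · simp [hg'0 t ht]
      · refine mul_le_of_le_one_left (norm_nonneg _) (exp_le_one_iff.2 ?_)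
        have : 0 ≤ (n : ℝ) * t := by positivity
        linarith
    have hee : ∀ y, (e ⋆[L, volume] e) y = exp (-(n * y)) * (g' ⋆[L, volume] g') y := by
      intro y
      rw [convolution_mul, convolution_mul, ← integral_const_mul]
      congr 1
      ext t
      have : exp (-(n * y)) = exp (-(n * t)) * exp (-(n * (y - t))) := by
        rw [← exp_add]; ring_nf
      rw [he, this]
      ring
    have hsq : (∫ t, e t) * (∫ t, e t) = ∫ y, exp (-(n * y)) * (g' ⋆[L, volume] g') y := by
      simp_rw [← hee]
      exact (integral_convolution L ie ie).symm
    have hle : |∫ y, exp (-(n * y)) * (g' ⋆[L, volume] g') y| ≤ exp (-(n * (2 * T))) * D := by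
      rw [hD, ← integral_const_mul, ← Real.norm_eq_abs]
      refine norm_integral_le_of_norm_le (iD.norm.const_mul _) ?_
      filter_upwards [hconv] with y hy
      rcases lt_or_ge y (2 * T) with hyT | hyT
      · simp [hy hyT]
      · rw [norm_mul, Real.norm_eq_abs, abs_exp]
        gcongr
    have hE : ∫ t, exp (n * (T - t)) * g' t = exp (n * T) * ∫ t, e t := by
      rw [← integral_const_mul]
      congr 1
      ext t
      rw [he, ← mul_assoc, ← exp_add]
      ring_nf
    refine Real.abs_le_sqrt ?_
    rw [hE, mul_pow, sq (∫ t, e t), hsq]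
    calc exp (n * T) ^ 2 * ∫ y, exp (-(n * y)) * (g' ⋆[L, volume] g') y
        ≤ exp (n * T) ^ 2 * (exp (-(n * (2 * T))) * D) := by
          gcongr
          exact (le_abs_self _).trans hle
      _ = D := by
          rw [← mul_assoc, sq, ← exp_add, ← exp_add]
          ring_nf
          simp
  refine ae_eq_zero_of_exp_moments_bounded (C := √D + ∫ t in Ico T (2 * T), |g t|) (hg T)
    fun n => ?_
  have ie : IntegrableOn (fun t => exp (n * (T - t)) * g t) (Ioo 0 (2 * T)) :=
    IntegrableOn.continuousOn_mul_of_subset (K := Icc 0 (2 * T))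
      (Continuous.continuousOn (by fun_prop)) (hg (2 * T)) isCompact_Icc measurableSet_Ioo
      Ioo_subset_Icc_self
  have hset : Ioo 0 (2 * T) = Ioo 0 T ∪ Ico T (2 * T) := by
    rw [Ioo_union_Ico_eq_Ioo hT (by linarith)]
  have hsplit : ∫ t, exp (n * (T - t)) * g' t =
      (∫ t in Ioo 0 T, exp (n * (T - t)) * g t) +
        ∫ t in Ico T (2 * T), exp (n * (T - t)) * g t := by
    rw [← setIntegral_union _ measurableSet_Ico (ie.mono_set (hset ▸ subset_union_left))
      (ie.mono_set (hset ▸ subset_union_right)), ← hset, ← integral_indicator measurableSet_Ioo]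
    · congr 1
      ext t
      rw [hg', indicator_mul_right]
    · rw [Set.disjoint_left]
      exact fun t ht ht' => absurd ht.2 (not_lt.2 ht'.1)
  have htail : |∫ t in Ico T (2 * T), exp (n * (T - t)) * g t| ≤ ∫ t in Ico T (2 * T), |g t| := by
    have ia : IntegrableOn (fun t => |g t|) (Ico T (2 * T)) :=
      Integrable.abs ((hg (2 * T)).mono_set (hset ▸ subset_union_right))
    rw [← Real.norm_eq_abs]
    refine norm_integral_le_of_norm_le ia ?_
    filter_upwards [ae_restrict_mem measurableSet_Ico] with t ht
    rw [norm_mul, Real.norm_eq_abs, abs_exp]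
    refine mul_le_of_le_one_left (norm_nonneg _) (exp_le_one_iff.2 ?_)
    exact mul_nonpos_of_nonneg_of_nonpos (Nat.cast_nonneg _) (by linarith [ht.1])
  have h1 := abs_le.1 (hmoment n)
  have h2 := abs_le.1 htail
  rw [abs_le]
  constructor <;> linarith

/-- If the convolution of two nonnegative functions on `(0,∞)` is finite everywhere and the second
function is not almost everywhere zero, then the first one is integrable near `0`. -/
theorem exists_setLIntegral_Ioo_lt_top {u v : ℝ → ENNReal} (hu : Measurable u) (hv : Measurable v)
    (hfin : ∀ x > 0, ∫⁻ s, u s * v (x - s) < ⊤) (hne : ¬ ∀ᵐ x, 0 < x → v x = 0) :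
    ∃ δ > 0, ∫⁻ s in Ioo 0 δ, u s < ⊤ := by
  set q : ℝ → ENNReal := fun x => ∫⁻ s, u s * v (x - s)
  have huv : Measurable fun p : ℝ × ℝ => u p.2 * v (p.1 - p.2) := by fun_prop
  have hq : Measurable q := huv.lintegral_prod_right'
  set A : ℕ → Set ℝ := fun n => {x | 0 < x ∧ ((n : ENNReal) + 1)⁻¹ ≤ v x ∧ q x ≤ n} with hA
  have hAm : ∀ n, MeasurableSet (A n) := fun n =>
    measurableSet_Ioi.inter ((measurableSet_le measurable_const hv).inter
      (measurableSet_le hq measurable_const))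
  obtain ⟨n, hn⟩ : ∃ n, 0 < volume (A n) := by
    by_contra! hcon
    refine hne ?_
    have hall := ae_all_iff.2 fun n => measure_eq_zero_iff_ae_notMem.1 (le_antisymm (hcon n) bot_le)
    filter_upwards [hall] with x hx hx0
    by_contra hvx
    obtain ⟨i, hi⟩ := ENNReal.exists_inv_nat_lt hvx
    obtain ⟨j, hj⟩ := ENNReal.exists_nat_gt (hfin x hx0).ne
    refine hx (max i j) ⟨hx0, ?_, hj.le.trans (by exact_mod_cast le_max_right i j)⟩
    refine le_trans (ENNReal.inv_le_inv.2 ?_) hi.le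
    exact le_trans (by exact_mod_cast le_max_left i j) le_self_add
  obtain ⟨K, hKA, hKc, hK⟩ := (hAm n).exists_lt_isCompact hn
  have hKm : MeasurableSet K := hKc.measurableSet
  have hKtop : volume K < ⊤ := hKc.measure_lt_top
  have hhalf : volume K / 2 ≠ 0 := by simp [hK.ne']
  have hev := eventually_nhds_zero_measure_vadd_sdiff_lt hKc hKc.isClosed hhalf (μ := volume)
  obtain ⟨δ, hδ, hball⟩ := Metric.eventually_nhds_iff.1 hev
  refine ⟨δ, hδ, ?_⟩
  set ε : ENNReal := ((n : ENNReal) + 1)⁻¹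
  have hε : ε ≠ 0 := by simp [ε]
  have hinner : ∀ s ∈ Ioo 0 δ, ε * (volume K / 2) ≤ ∫⁻ x in K, v (x - s) := by
    intro s hs
    have hlt : volume ((s +ᵥ K) \ K) < volume K / 2 :=
      hball (by rw [Real.dist_eq, sub_zero, abs_of_pos hs.1]; exact hs.2)
    have hsK : MeasurableSet (s +ᵥ K) := hKm.const_vadd s
    have hmeas : volume K / 2 ≤ volume ((s +ᵥ K) ∩ K) := by
      have h1 : volume ((s +ᵥ K) ∩ K) + volume ((s +ᵥ K) \ K) = volume K := by
        rw [measure_inter_add_sdiff _ hKm, measure_vadd]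
      by_contra! hc
      have := ENNReal.add_lt_add hc hlt
      rw [h1, ENNReal.add_halves] at this
      exact lt_irrefl _ this
    calc ε * (volume K / 2) ≤ ε * volume ((s +ᵥ K) ∩ K) := by gcongr
      _ = ∫⁻ _ in (s +ᵥ K) ∩ K, ε := by rw [setLIntegral_const]
      _ ≤ ∫⁻ x in (s +ᵥ K) ∩ K, v (x - s) := by
          refine setLIntegral_mono' (hsK.inter hKm) fun x hx => ?_
          obtain ⟨y, hy, rfl⟩ := mem_vadd_set.1 hx.1
          have : (s +ᵥ y) - s = y := by simp
          rw [this]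
          exact (hKA hy).2.1
      _ ≤ ∫⁻ x in K, v (x - s) := lintegral_mono_set inter_subset_right
  have hchain : (∫⁻ s in Ioo 0 δ, u s) * (ε * (volume K / 2)) ≤ n * volume K := by
    calc (∫⁻ s in Ioo 0 δ, u s) * (ε * (volume K / 2))
        = ∫⁻ s in Ioo 0 δ, u s * (ε * (volume K / 2)) := by rw [lintegral_mul_const _ hu]
      _ ≤ ∫⁻ s in Ioo 0 δ, u s * ∫⁻ x in K, v (x - s) :=
          setLIntegral_mono' measurableSet_Ioo fun s hs => by gcongr; exact hinner s hs
      _ ≤ ∫⁻ s, u s * ∫⁻ x in K, v (x - s) := setLIntegral_le_lintegral _ _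
      _ = ∫⁻ s, ∫⁻ x in K, u s * v (x - s) := by
          congr 1
          ext s
          rw [lintegral_const_mul _ (by fun_prop)]
      _ = ∫⁻ x in K, q x := by
          rw [lintegral_lintegral_swap]
          exact (huv.comp measurable_swap).aemeasurable
      _ ≤ ∫⁻ _ in K, (n : ENNReal) := setLIntegral_mono' hKm fun x hx => (hKA hx).2.2
      _ = n * volume K := by rw [setLIntegral_const]
  by_contra! htop
  rw [top_le_iff.1 htop, ENNReal.top_mul (mul_ne_zero hε hhalf)] at hchain
  exact absurd hchain (not_le.2 (ENNReal.mul_lt_top (by simp) hKtop))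

theorem locInt_of_lconv_ne_zero {u v : ℝ → ℝ} (hu : LocallyIntegrableOn u (Ioi 0))
    (hv : LocallyIntegrableOn v (Ioi 0)) (h : ∀ x > 0, lconv u v x ≠ 0) : LocInt u := by
  have mu := hu.aestronglyMeasurable
  have mv := hv.aestronglyMeasurable
  set u' : ℝ → ENNReal := (Ioi 0).indicator fun t => ‖mu.mk u t‖ₑ with hu'
  set v' : ℝ → ENNReal := (Ioi 0).indicator fun t => ‖mv.mk v t‖ₑ with hv'
  have eu : ∀ᵐ t, t ∈ Ioi 0 → u t = mu.mk u t := (ae_restrict_iff' measurableSet_Ioi).1 mu.ae_eq_mk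
  have ev : ∀ᵐ t, t ∈ Ioi 0 → v t = mv.mk v t := (ae_restrict_iff' measurableSet_Ioi).1 mv.ae_eq_mk
  have hu'm : Measurable u' := mu.stronglyMeasurable_mk.enorm.indicator measurableSet_Ioi
  have hv'm : Measurable v' := mv.stronglyMeasurable_mk.enorm.indicator measurableSet_Ioi
  have hfin : ∀ x > 0, ∫⁻ s, u' s * v' (x - s) < ⊤ := by
    intro x hx
    have hne := h x hx
    rw [lconv_comm, lconv_eq_setIntegral _ _ hx.le] at hne
    have hint : IntegrableOn (fun t => v (x - t) * u t) (Ioo 0 x) := by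
      by_contra hni
      exact hne (integral_undef hni)
    have hlt := hint.2
    rw [HasFiniteIntegral, ← lintegral_indicator measurableSet_Ioo] at hlt
    refine lt_of_le_of_lt (lintegral_mono_ae ?_) hlt
    have ev' : ∀ᵐ t, x - t ∈ Ioi 0 → v (x - t) = mv.mk v (x - t) :=
      (quasiMeasurePreserving_sub_left_of_right_invariant volume x).ae ev
    filter_upwards [eu, ev'] with t ht1 ht2
    by_cases h0 : t ∈ Ioi 0
    · by_cases h1 : x - t ∈ Ioi 0
      · have htx : t ∈ Ioo 0 x := ⟨h0, by simpa using h1⟩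
        rw [hu', hv', indicator_of_mem h0, indicator_of_mem h1, indicator_of_mem htx, ← ht1 h0,
          ← ht2 h1, enorm_mul, mul_comm]
      · rw [hv', indicator_of_notMem h1, mul_zero]; exact bot_le
    · rw [hu', indicator_of_notMem h0, zero_mul]; exact bot_le
  have hne : ¬ ∀ᵐ x, 0 < x → v' x = 0 := by
    intro hz
    refine h 1 one_pos ?_
    rw [lconv_congr_right (w := fun _ => 0) zero_le_one]
    · simp [lconv]
    · filter_upwards [hz, ev] with t ht1 ht2 ht
      have := ht1 ht.1
      rw [hv', indicator_of_mem (show t ∈ Ioi 0 from ht.1)] at this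
      rw [ht2 ht.1]
      simpa using this
  obtain ⟨δ, hδ, hlt⟩ := exists_setLIntegral_Ioo_lt_top hu'm hv'm hfin hne
  have hnear : IntegrableOn u (Ioo 0 δ) := by
    refine ⟨mu.mono_measure (Measure.restrict_mono Ioo_subset_Ioi_self le_rfl), ?_⟩
    refine lt_of_le_of_lt (lintegral_mono_ae ?_) hlt
    filter_upwards [ae_restrict_mem measurableSet_Ioo, ae_restrict_of_ae eu] with t ht1 ht2
    rw [hu', indicator_of_mem (show t ∈ Ioi 0 from ht1.1), ht2 ht1.1]
  intro X
  have hfar : IntegrableOn u (Icc (δ / 2) X) :=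
    hu.integrableOn_compact_subset (fun t ht => lt_of_lt_of_le (half_pos hδ) ht.1) isCompact_Icc
  refine (hnear.union hfar).mono_set fun t ht => ?_
  rcases lt_or_ge t δ with h1 | h1
  · exact Or.inl ⟨ht.1, h1⟩
  · exact Or.inr ⟨by linarith, ht.2.le⟩

theorem LocBdd.convPow_succ {f : ℝ → ℝ} (hf : LocBdd f) : ∀ n : ℕ, LocBdd (convPow f (n + 1))
  | 0 => hf
  | n + 1 => hf.locInt.lconv_locBdd (LocBdd.convPow_succ hf n)

theorem abs_convPow_le {f : ℝ → ℝ} {X C : ℝ} (hC : ∀ t ∈ Ioo 0 X, |f t| ≤ C) (n : ℕ) :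
    ∀ x ∈ Ioo 0 X, |convPow f (n + 1) x| ≤ C ^ (n + 1) * (x ^ n / n.factorial) := by
  induction n with
  | zero => intro x hx; simpa [convPow] using hC x hx
  | succ n ih =>
    intro x hx
    have hC0 : 0 ≤ C := (abs_nonneg _).trans (hC x hx)
    have hle : ‖∫ t in (0:ℝ)..x, f (x - t) * convPow f (n + 1) t‖ ≤
        ∫ t in (0:ℝ)..x, C * (C ^ (n + 1) * (t ^ n / n.factorial)) := by
      refine intervalIntegral.norm_integral_le_of_norm_le hx.1.le ?_
        (Continuous.intervalIntegrable (by fun_prop) _ _)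
      filter_upwards [Measure.ae_ne volume x] with t htx ht
      have htx' : t < x := lt_of_le_of_ne ht.2 htx
      rw [norm_mul]
      exact mul_le_mul (hC _ ⟨by linarith, by linarith [ht.1, hx.2]⟩)
        (ih t ⟨ht.1, htx'.trans hx.2⟩) (abs_nonneg _) hC0
    refine hle.trans (le_of_eq ?_)
    rw [intervalIntegral.integral_const_mul, intervalIntegral.integral_const_mul,
      intervalIntegral.integral_div, integral_pow, Nat.factorial_succ]
    push_cast
    field_simp
    simp
    ring

theorem LocBdd.exists_convPow_bound {f : ℝ → ℝ} (hf : LocBdd f) (X : ℝ) :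
    ∃ B R : ℝ, 0 ≤ B ∧ 0 ≤ R ∧
      ∀ n : ℕ, ∀ x ∈ Ioo 0 X, |convPow f (n + 1) x| ≤ B * (R ^ n / n.factorial) := by
  rcases le_or_gt X 0 with hX | hX
  · exact ⟨0, 0, le_rfl, le_rfl, fun n x hx => absurd (hx.1.trans hx.2) (not_lt.2 hX)⟩
  obtain ⟨C, hC⟩ := hf.2 X
  have hC0 : 0 ≤ C := (abs_nonneg _).trans (hC (X / 2) ⟨by linarith, by linarith⟩)
  refine ⟨C, C * X, hC0, by positivity, fun n x hx => (abs_convPow_le hC n x hx).trans ?_⟩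
  have hx0 := hx.1
  calc C ^ (n + 1) * (x ^ n / n.factorial) ≤ C ^ (n + 1) * (X ^ n / n.factorial) := by
        gcongr
        exact hx.2.le
    _ = C * ((C * X) ^ n / n.factorial) := by rw [mul_pow]; ring

theorem lconv_convPow {f : ℝ → ℝ} (hf : LocBdd f) (m n : ℕ) {x : ℝ} (hx : 0 ≤ x) :
    lconv (convPow f (m + 1)) (convPow f (n + 1)) x = convPow f (m + n + 2) x := by
  induction m generalizing x with
  | zero => rw [zero_add, zero_add]; rfl
  | succ m ih =>
    have h := lconv_assoc hf.locInt (hf.convPow_succ m).locInt (hf.convPow_succ n) hx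
    rw [show m + 1 + n + 2 = (m + n + 1) + 2 by omega]
    refine h.trans (lconv_congr_right hx (Eventually.of_forall fun t ht => ?_))
    exact ih ht.1.le

/-- A convolution power can only vanish if the function itself vanishes. -/
theorem ae_eq_zero_of_convPow_ae_eq_zero {f : ℝ → ℝ} (hf : LocBdd f) (m : ℕ)
    (h : ∀ᵐ x, 0 < x → convPow f (m + 1) x = 0) : ∀ᵐ x, 0 < x → f x = 0 := by
  induction m with
  | zero => exact h
  | succ m ih =>
    refine ih (ae_eq_zero_of_lconv_self_eq_zero (hf.convPow_succ m).locInt ?_)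
    cases m with
    | zero => exact h
    | succ k =>
      refine Eventually.of_forall fun x hx => ?_
      rw [lconv_convPow hf _ _ hx.le, show k + 1 + (k + 1) + 2 = k + (k + 2) + 2 by omega,
        ← lconv_convPow hf _ _ hx.le, lconv_congr_right (w := fun _ => 0) hx.le]
      · simp [lconv]
      · filter_upwards [h] with t ht htx using ht htx.1

/-- The homogeneous Volterra equation of the second kind has only the trivial solution. -/
theorem ae_eq_zero_of_eq_lconv {F h : ℝ → ℝ} (hF : LocBdd F) (hh : LocBdd h)
    (heq : ∀ᵐ x, 0 < x → F x = lconv F h x) : ∀ᵐ x, 0 < x → F x = 0 := by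
  have hpow : ∀ n : ℕ, ∀ᵐ x, 0 < x → F x = lconv F (convPow h (n + 1)) x := by
    intro n
    induction n with
    | zero => exact heq
    | succ n ih =>
      filter_upwards [ih] with x hx hx0
      have h1 := lconv_assoc hF.locInt hh.locInt (hh.convPow_succ n) hx0.le
      refine (hx hx0).trans (Eq.trans ?_ h1)
      refine lconv_congr_left hx0.le ?_
      filter_upwards [heq] with t ht htx using ht htx.1
  filter_upwards [ae_all_iff.2 hpow] with x hx hx0
  obtain ⟨B, R, -, -, hB⟩ := hh.exists_convPow_bound x
  have hlim : Tendsto (fun n : ℕ => (∫ t in Ioo 0 x, |F t|) * (B * (R ^ n / n.factorial))) atTop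
      (𝓝 0) := by
    simpa using ((FloorSemiring.tendsto_pow_div_factorial_atTop R).const_mul B).const_mul
      (∫ t in Ioo 0 x, |F t|)
  have hle : |F x| ≤ 0 := by
    refine ge_of_tendsto' hlim fun n => ?_
    rw [hx n hx0]
    exact abs_lconv_le hF.locInt hx0.le (hB n)
  exact abs_nonpos_iff.1 hle

/-- At most geometric growth of a sequence of coefficients. -/
def GeomBdd (c : ℕ → ℝ) : Prop := ∃ A ρ : ℝ, 0 ≤ A ∧ 0 ≤ ρ ∧ ∀ n, |c n| ≤ A * ρ ^ n

theorem geomBdd_of_summable {c : ℕ → ℝ} (h : ∃ r > (0:ℝ), Summable fun n : ℕ => |c n| * r ^ n) :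
    GeomBdd c := by
  obtain ⟨r, hr, hs⟩ := h
  have hpos : ∀ n, 0 ≤ |c n| * r ^ n := fun n => by positivity
  refine ⟨∑' n, |c n| * r ^ n, r⁻¹, tsum_nonneg hpos, by positivity, fun n => ?_⟩
  have := hs.le_tsum n fun j _ => hpos j
  rw [inv_pow, ← div_eq_mul_inv, le_div_iff₀ (by positivity)]
  exact this

theorem GeomBdd.shift {c : ℕ → ℝ} (h : GeomBdd c) (m : ℕ) : GeomBdd fun n => c (m + n) := by
  obtain ⟨A, ρ, hA, hρ, hc⟩ := h
  exact ⟨A * ρ ^ m, ρ, by positivity, hρ, fun n => (hc _).trans (le_of_eq (by rw [pow_add]; ring))⟩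

theorem GeomBdd.antidiagonal {a b : ℕ → ℝ} (ha : GeomBdd a) (hb : GeomBdd b) :
    GeomBdd fun n => ∑ p ∈ Finset.HasAntidiagonal.antidiagonal n, a p.1 * b p.2 := by
  obtain ⟨A, ρ, hA, hρ, ha⟩ := ha
  obtain ⟨B, σ, hB, hσ, hb⟩ := hb
  refine ⟨A * B, ρ + σ, by positivity, by positivity, fun n => ?_⟩
  calc |∑ p ∈ Finset.HasAntidiagonal.antidiagonal n, a p.1 * b p.2|
      ≤ ∑ p ∈ Finset.HasAntidiagonal.antidiagonal n, |a p.1 * b p.2| :=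
        Finset.abs_sum_le_sum_abs _ _
    _ ≤ ∑ p ∈ Finset.HasAntidiagonal.antidiagonal n,
        A * B * (n.choose p.1 * (ρ ^ p.1 * σ ^ p.2)) := by
        refine Finset.sum_le_sum fun p hp => ?_
        have hchoose : (1:ℝ) ≤ n.choose p.1 := by
          have hpn := Finset.HasAntidiagonal.mem_antidiagonal.1 hp
          exact_mod_cast Nat.choose_pos (by omega)
        calc |a p.1 * b p.2| ≤ A * ρ ^ p.1 * (B * σ ^ p.2) := by
              rw [abs_mul]
              exact mul_le_mul (ha _) (hb _) (abs_nonneg _) (by positivity)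
          _ = A * B * (1 * (ρ ^ p.1 * σ ^ p.2)) := by ring
          _ ≤ A * B * (n.choose p.1 * (ρ ^ p.1 * σ ^ p.2)) := by gcongr
    _ = A * B * (ρ + σ) ^ n := by
        rw [← Finset.mul_sum, (Commute.all ρ σ).add_pow']
        simp [nsmul_eq_mul]

/-- The convolution series `∑ cₙ f^{<n>}`, summed over `n ≥ 1`. -/
noncomputable def convSeries (f : ℝ → ℝ) (c : ℕ → ℝ) (x : ℝ) : ℝ :=
  ∑' n : ℕ, c (n + 1) * convPow f (n + 1) x

theorem LocBdd.exists_convSeries_majorant {f : ℝ → ℝ} {c : ℕ → ℝ} (hf : LocBdd f)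
    (hc : GeomBdd c) (X : ℝ) :
    ∃ M : ℕ → ℝ, Summable M ∧ ∀ n, ∀ x ∈ Ioo 0 X, |c (n + 1) * convPow f (n + 1) x| ≤ M n := by
  obtain ⟨B, R, hB, hR, hfB⟩ := hf.exists_convPow_bound X
  obtain ⟨A, ρ, hA, hρ, hcA⟩ := hc
  refine ⟨fun n => A * ρ * B * ((ρ * R) ^ n / n.factorial),
    (Real.summable_pow_div_factorial (ρ * R)).mul_left _, fun n x hx => ?_⟩
  rw [abs_mul]
  calc |c (n + 1)| * |convPow f (n + 1) x| ≤ A * ρ ^ (n + 1) * (B * (R ^ n / n.factorial)) :=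
        mul_le_mul (hcA _) (hfB n x hx) (abs_nonneg _) (by positivity)
    _ = A * ρ * B * ((ρ * R) ^ n / n.factorial) := by rw [mul_pow]; ring

theorem LocBdd.hasSum_convSeries {f : ℝ → ℝ} {c : ℕ → ℝ} (hf : LocBdd f) (hc : GeomBdd c) {x : ℝ}
    (hx : 0 < x) : HasSum (fun n => c (n + 1) * convPow f (n + 1) x) (convSeries f c x) := by
  obtain ⟨M, hM, hle⟩ := hf.exists_convSeries_majorant hc (x + 1)
  exact (Summable.of_norm_bounded hM fun n => hle n x ⟨hx, by linarith⟩).hasSum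

theorem LocBdd.locBdd_convSeries {f : ℝ → ℝ} {c : ℕ → ℝ} (hf : LocBdd f) (hc : GeomBdd c) :
    LocBdd (convSeries f c) := by
  refine ⟨?_, fun X => ?_⟩
  · refine aestronglyMeasurable_of_tendsto_ae atTop
      (f := fun N x => ∑ n ∈ Finset.range N, c (n + 1) * convPow f (n + 1) x) (fun N => ?_) ?_
    · exact Finset.aestronglyMeasurable_fun_sum _ fun n _ => ((hf.convPow_succ n).1.const_mul _)
    · exact (ae_restrict_iff' measurableSet_Ioi).2
        (Eventually.of_forall fun x hx => (hf.hasSum_convSeries hc hx).tendsto_sum_nat)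
  · obtain ⟨M, hM, hle⟩ := hf.exists_convSeries_majorant hc X
    exact ⟨∑' n, M n, fun t ht =>
      (tsum_of_norm_bounded hM.hasSum fun n => hle n t ht :
        ‖∑' n, c (n + 1) * convPow f (n + 1) t‖ ≤ _)⟩

theorem hasSum_lconv_convSeries {u f : ℝ → ℝ} {c : ℕ → ℝ} (hu : LocInt u) (hf : LocBdd f)
    (hc : GeomBdd c) {x : ℝ} (hx : 0 ≤ x) :
    HasSum (fun n => c (n + 1) * lconv u (convPow f (n + 1)) x) (lconv u (convSeries f c) x) := by
  obtain ⟨M, hM, hle⟩ := hf.exists_convSeries_majorant hc x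
  have hux : IntegrableOn (fun t => u (x - t)) (Ioo 0 x) := hu.integrableOn_comp_sub_left x
  simp_rw [← lconv_const_mul_right, lconv_eq_setIntegral _ _ hx]
  refine hasSum_integral_of_dominated_convergence (fun n t => |u (x - t)| * M n) (fun n => ?_)
    (fun n => ?_) ?_ ?_ ?_
  · exact hux.1.mul (((hf.convPow_succ n).1.const_mul _).mono_measure
      (Measure.restrict_mono Ioo_subset_Ioi_self le_rfl))
  · refine (ae_restrict_iff' measurableSet_Ioo).2 (Eventually.of_forall fun t ht => ?_)
    rw [norm_mul]
    exact mul_le_mul_of_nonneg_left (hle n t ht) (abs_nonneg _)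
  · exact Eventually.of_forall fun t => hM.mul_left _
  · simp_rw [tsum_mul_left]
    exact hux.abs.mul_const _
  · refine (ae_restrict_iff' measurableSet_Ioo).2 (Eventually.of_forall fun t ht => ?_)
    exact (hf.hasSum_convSeries hc ht.1).mul_left _

theorem hasSum_lconv_convSeries_convSeries {f : ℝ → ℝ} {a b : ℕ → ℝ} (hf : LocBdd f)
    (ha : GeomBdd a) (hb : GeomBdd b) {x : ℝ} (hx : 0 < x) :
    HasSum (fun n => (∑ p ∈ Finset.HasAntidiagonal.antidiagonal n, a (p.1 + 1) * b (p.2 + 1)) *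
      convPow f (n + 2) x) (lconv (convSeries f a) (convSeries f b) x) := by
  set g : ℕ × ℕ → ℝ := fun p => a (p.1 + 1) * (b (p.2 + 1) * convPow f (p.1 + p.2 + 2) x) with hg
  have hgs : Summable g := by
    obtain ⟨B, R, hB, hR, hfB⟩ := hf.exists_convPow_bound (x + 1)
    obtain ⟨A, ρ, hA, hρ, haA⟩ := ha
    obtain ⟨D, σ, hD, hσ, hbD⟩ := hb
    have hs := ((Real.summable_pow_div_factorial (ρ * R)).mul_of_nonneg
      (Real.summable_pow_div_factorial (σ * R)) (fun n => by positivity)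
      (fun n => by positivity)).mul_left (A * ρ * (D * σ) * (B * R))
    refine Summable.of_norm_bounded hs fun p => ?_
    have hfac : (((p.1 + p.2 + 1).factorial : ℝ))⁻¹ ≤
        ((p.1.factorial : ℝ) * p.2.factorial)⁻¹ := by
      have h1 : p.1.factorial * p.2.factorial ≤ (p.1 + p.2 + 1).factorial :=
        (Nat.le_of_dvd (Nat.factorial_pos _)
          (Nat.factorial_mul_factorial_dvd_factorial_add _ _)).trans
          (Nat.factorial_le (Nat.le_succ _))
      have h2 : (0:ℝ) < (p.1.factorial : ℝ) * p.2.factorial := by positivity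
      exact inv_anti₀ h2 (by exact_mod_cast h1)
    calc ‖g p‖ ≤ A * ρ ^ (p.1 + 1) * (D * σ ^ (p.2 + 1) *
          (B * (R ^ (p.1 + p.2 + 1) / (p.1 + p.2 + 1).factorial))) := by
          rw [hg, norm_mul, norm_mul]
          exact mul_le_mul (haA _) (mul_le_mul (hbD _) (hfB (p.1 + p.2 + 1) x ⟨hx, by linarith⟩)
            (abs_nonneg _) (by positivity)) (by positivity) (by positivity)
      _ ≤ A * ρ ^ (p.1 + 1) * (D * σ ^ (p.2 + 1) *
          (B * (R ^ (p.1 + p.2 + 1) * ((p.1.factorial : ℝ) * p.2.factorial)⁻¹))) := by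
          rw [div_eq_mul_inv]
          gcongr
      _ = _ := by
          rw [mul_inv, mul_pow, mul_pow]
          ring
  have houter : HasSum (fun m => a (m + 1) * lconv (convPow f (m + 1)) (convSeries f b) x)
      (lconv (convSeries f a) (convSeries f b) x) := by
    rw [lconv_comm]
    simp_rw [lconv_comm (convPow f _) (convSeries f b)]
    exact hasSum_lconv_convSeries (hf.locBdd_convSeries hb).locInt hf ha hx.le
  have hinner : ∀ m, HasSum (fun n => g (m, n))
      (a (m + 1) * lconv (convPow f (m + 1)) (convSeries f b) x) := by
    intro m
    have := (hasSum_lconv_convSeries (hf.convPow_succ m).locInt hf hb hx.le).mul_left (a (m + 1))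
    simp_rw [lconv_convPow hf _ _ hx.le] at this
    exact this
  have htot : HasSum g (lconv (convSeries f a) (convSeries f b) x) := by
    have h1 := hgs.hasSum.prod_fiberwise hinner
    rw [← h1.unique houter]
    exact hgs.hasSum
  have h2 := (Finset.HasAntidiagonal.sigmaAntidiagonalEquivProd (A := ℕ)).hasSum_iff.2 htot
  have h3 := h2.sigma fun n => hasSum_fintype _
  refine h3.congr_fun fun n => ?_
  rw [Finset.sum_mul, ← Finset.sum_coe_sort]
  refine Finset.sum_congr rfl fun p _ => ?_
  have hp : p.1.1 + p.1.2 = n := Finset.HasAntidiagonal.mem_antidiagonal.1 p.2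
  change _ = a (p.1.1 + 1) * (b (p.1.2 + 1) * convPow f (p.1.1 + p.1.2 + 2) x)
  rw [hp, mul_assoc]

theorem convSeries_antidiagonal {f : ℝ → ℝ} {a b : ℕ → ℝ} (hf : LocBdd f)
    (ha : GeomBdd a) (hb : GeomBdd b) {x : ℝ} (hx : 0 < x) :
    convSeries f (fun n => ∑ p ∈ Finset.HasAntidiagonal.antidiagonal n, a p.1 * b p.2) x =
      a 0 * convSeries f b x + b 0 * convSeries f a x +
        lconv (convSeries f a) (convSeries f b) x := by
  refine (hf.hasSum_convSeries (ha.antidiagonal hb) hx).unique ?_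
  have h1 := ((hf.hasSum_convSeries hb hx).mul_left (a 0)).add
    ((hf.hasSum_convSeries ha hx).mul_left (b 0))
  have h2 : HasSum (fun n => Nat.casesOn n 0 fun n =>
      (∑ p ∈ Finset.HasAntidiagonal.antidiagonal n, a (p.1 + 1) * b (p.2 + 1)) *
      convPow f (n + 2) x) (lconv (convSeries f a) (convSeries f b) x) := by
    rw [← hasSum_nat_add_iff' 1]
    simpa using hasSum_lconv_convSeries_convSeries hf ha hb hx
  refine (h1.add h2).congr_fun fun n => ?_
  cases n with
  | zero =>
    simp [Finset.Nat.sum_antidiagonal_succ]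
    ring
  | succ n =>
    rw [Finset.Nat.sum_antidiagonal_succ, Finset.Nat.sum_antidiagonal_succ']
    simp only
    ring

theorem GeomBdd.eq_zero_of_convSeries_ae_eq_zero {f : ℝ → ℝ} {c : ℕ → ℝ} (hf : LocBdd f)
    (hc : GeomBdd c) (hne : ¬ ∀ᵐ x, 0 < x → f x = 0)
    (h : ∀ᵐ x, 0 < x → convSeries f c x = 0) (n : ℕ) : c (n + 1) = 0 := by
  induction n using Nat.strong_induction_on with
  | _ m ih =>
    by_contra hcm
    refine hne (ae_eq_zero_of_convPow_ae_eq_zero hf m ?_)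
    have hc' := hc.shift (m + 1)
    refine ae_eq_zero_of_eq_lconv (hf.convPow_succ m)
      ((hf.locBdd_convSeries hc').const_mul (-(c (m + 1))⁻¹)) ?_
    filter_upwards [h] with x hx hx0
    have h1 := hasSum_lconv_convSeries (hf.convPow_succ m).locInt hf hc' hx0.le
    simp_rw [lconv_convPow hf _ _ hx0.le] at h1
    have h2 := (hasSum_nat_add_iff' (m + 1)).2 (hf.hasSum_convSeries hc hx0)
    have h3 : ∑ i ∈ Finset.range (m + 1), c (i + 1) * convPow f (i + 1) x =
        c (m + 1) * convPow f (m + 1) x := by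
      rw [Finset.sum_range_succ, Finset.sum_eq_zero, zero_add]
      intro i hi
      rw [ih i (Finset.mem_range.1 hi), zero_mul]
    rw [h3, hx hx0] at h2
    have h4 : lconv (convPow f (m + 1)) (convSeries f fun n => c (m + 1 + n)) x =
        0 - c (m + 1) * convPow f (m + 1) x := by
      refine h1.unique ?_
      refine h2.congr_fun fun n => ?_
      rw [show m + 1 + (n + 1) = n + (m + 1) + 1 by omega, show m + n + 2 = n + (m + 1) + 1 by omega]
    rw [lconv_const_mul_right, h4]
    field_simp
    ring

theorem locBdd_of_continuousOn {u : ℝ → ℝ} (hu : ContinuousOn u (Ici 0)) : LocBdd u := by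
  refine ⟨(hu.mono Ioi_subset_Ici_self).aestronglyMeasurable measurableSet_Ioi, fun X => ?_⟩
  obtain ⟨C, hC⟩ := (isCompact_Icc (a := (0:ℝ)) (b := X)).exists_bound_of_continuousOn
    (hu.mono Icc_subset_Ici_self)
  exact ⟨C, fun t ht => hC t (Ioo_subset_Icc_self ht)⟩

theorem lconv_one_left (v : ℝ → ℝ) (x : ℝ) : lconv (fun _ => 1) v x = ∫ t in (0:ℝ)..x, v t := by
  simp [lconv]

/-- If `κ₁ * k₁ = 1`, then `(a κ₁ + κ₁ * A) * (b k₁ + k₁ * B) = a b + 1 * (a B + b A + A * B)`. -/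
theorem lconv_sonin_perturbation {κ₁ k₁ A B : ℝ → ℝ} {α β : ℝ} (hκ₁ : LocInt κ₁) (hk₁ : LocInt k₁)
    (hS : ∀ x > 0, lconv κ₁ k₁ x = 1) (hA : LocBdd A) (hB : LocBdd B) {x : ℝ} (hx : 0 < x) :
    lconv (fun t => α * κ₁ t + lconv κ₁ A t) (fun t => β * k₁ t + lconv k₁ B t) x =
      α * β + ∫ t in (0:ℝ)..x, (α * B t + β * A t + lconv A B t) := by
  have hκA := hκ₁.lconv_locBdd hA
  have hkB := hk₁.lconv_locBdd hB
  have hi1 : IntervalIntegrable (fun t => κ₁ (x - t) * k₁ t) volume 0 x :=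
    intervalIntegral.intervalIntegrable_of_integral_ne_zero (by
      change lconv κ₁ k₁ x ≠ 0
      rw [hS x hx]
      exact one_ne_zero)
  have hi2 := hκ₁.intervalIntegrable_lconv hkB hx.le
  have hi3 : IntervalIntegrable (fun t => lconv κ₁ A (x - t) * k₁ t) volume 0 x := by
    have := (hk₁.intervalIntegrable_lconv hκA hx.le).comp_sub_left x
    simp only [sub_sub_cancel, sub_zero, sub_self] at this
    simpa only [mul_comm] using this.symm
  have hi4 := hκA.locInt.intervalIntegrable_lconv hkB hx.le
  have hint : ∀ {u : ℝ → ℝ}, LocBdd u → IntervalIntegrable u volume 0 x := fun hu =>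
    (intervalIntegrable_iff_integrableOn_Ioo_of_le hx.le).2 (hu.locInt x)
  have hsplit : lconv (fun t => α * κ₁ t + lconv κ₁ A t) (fun t => β * k₁ t + lconv k₁ B t) x =
      α * β * lconv κ₁ k₁ x + α * lconv κ₁ (lconv k₁ B) x + β * lconv (lconv κ₁ A) k₁ x +
        lconv (lconv κ₁ A) (lconv k₁ B) x := by
    unfold lconv at hi2 hi3 hi4 ⊢
    rw [← intervalIntegral.integral_const_mul, ← intervalIntegral.integral_const_mul,
      ← intervalIntegral.integral_const_mul, ← intervalIntegral.integral_add
      (hi1.const_mul _) (hi2.const_mul _), ← intervalIntegral.integral_add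
      ((hi1.const_mul _).add (hi2.const_mul _)) (hi3.const_mul _), ← intervalIntegral.integral_add
      (((hi1.const_mul _).add (hi2.const_mul _)).add (hi3.const_mul _)) hi4]
    congr 1 with t
    ring
  have hone : ∀ {u : ℝ → ℝ}, LocBdd u → ∀ y, 0 ≤ y →
      lconv κ₁ (lconv k₁ u) y = ∫ t in (0:ℝ)..y, u t := fun {u} hu y hy => by
    rw [← lconv_assoc hκ₁ hk₁ hu hy, ← lconv_one_left]
    exact lconv_congr_left hy (Eventually.of_forall fun t ht => hS t ht.1)
  have h3 : lconv (lconv κ₁ A) k₁ x = ∫ t in (0:ℝ)..x, A t := by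
    rw [lconv_comm, ← hone hA x hx.le, ← lconv_assoc hk₁ hκ₁ hA hx.le,
      ← lconv_assoc hκ₁ hk₁ hA hx.le]
    simp_rw [funext (lconv_comm k₁ κ₁)]
  have h4 : lconv (lconv κ₁ A) (lconv k₁ B) x = ∫ t in (0:ℝ)..x, lconv A B t := by
    rw [lconv_assoc hκ₁ hA.locInt hkB hx.le, ← hone (hA.locInt.lconv_locBdd hB) x hx.le]
    refine lconv_congr_right hx.le (Eventually.of_forall fun t ht => ?_)
    rw [← lconv_assoc hA.locInt hk₁ hB ht.1.le, ← lconv_assoc hk₁ hA.locInt hB ht.1.le]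
    simp_rw [funext (lconv_comm k₁ A)]
  rw [hsplit, hS x hx, hone hB x hx.le, h3, h4,
    intervalIntegral.integral_add (((hint hB).const_mul _).add ((hint hA).const_mul _))
      (hint (hA.locInt.lconv_locBdd hB)),
    intervalIntegral.integral_add ((hint hB).const_mul _) ((hint hA).const_mul _),
    intervalIntegral.integral_const_mul, intervalIntegral.integral_const_mul]
  ring

/-- A primitive of a locally bounded function can only cancel a constant if both vanish. -/
theorem LocBdd.eq_zero_of_const_add_integral_eq_zero {s : ℝ → ℝ} {γ : ℝ} (hs : LocBdd s)
    (h : ∀ x > 0, γ + ∫ t in (0:ℝ)..x, s t = 0) : γ = 0 ∧ ∀ᵐ x, 0 < x → s x = 0 := by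
  have hγ : γ = 0 := by
    obtain ⟨C, hC⟩ := hs.2 1
    have hlim : Tendsto (fun x : ℝ => C * x) (𝓝[>] 0) (𝓝 0) := by
      have : Tendsto (fun x : ℝ => C * x) (𝓝 0) (𝓝 (C * 0)) := (continuous_const_mul C).tendsto 0
      rw [mul_zero] at this
      exact this.mono_left nhdsWithin_le_nhds
    have hle : |γ| ≤ 0 := by
      refine ge_of_tendsto hlim ?_
      filter_upwards [Ioo_mem_nhdsGT (zero_lt_one (α := ℝ))] with x hx
      have h1 : γ = -∫ t in (0:ℝ)..x, s t := by linarith [h x hx.1]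
      rw [h1, abs_neg]
      have hbound : ‖∫ t in (0:ℝ)..x, s t‖ ≤ C * |x - 0| := by
        refine intervalIntegral.norm_integral_le_of_norm_le_const fun t ht => ?_
        rw [uIoc_of_le hx.1.le] at ht
        exact hC t ⟨ht.1, ht.2.trans_lt hx.2⟩
      rwa [sub_zero, abs_of_pos hx.1] at hbound
    exact abs_nonpos_iff.1 hle
  refine ⟨hγ, ?_⟩
  have hn : ∀ n : ℕ, ∀ᵐ x, x ∈ Ioo (0:ℝ) n → s x = 0 := fun n =>
    ae_eq_zero_of_intervalIntegral_eq_zero (hs.locInt n) fun x hx => by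
      have := h x hx.1
      rwa [hγ, zero_add] at this
  filter_upwards [ae_all_iff.2 hn] with x hx hx0
  obtain ⟨n, hxn⟩ := exists_nat_gt x
  exact hx n ⟨hx0, hxn⟩

end

/-- Sonin kernels built from convolution series: `κ = a₀κ₁ + κ₁ * Σₙ₌₁ aₙ f^{<n>}` and
`k = b₀k₁ + k₁ * Σₙ₌₁ bₙ f^{<n>}` form a pair of Sonin kernels iff `a₀b₀ = 1` and the
Cauchy products `Σ aₘ b₍ₙ₋ₘ₎` vanish for `n ≥ 1`. -/
theorem sonin_kernels_convolution_series_iff (κ₁ k₁ f₁ : ℝ → ℝ) (p : ℝ) (hp : 0 < p)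
    (hκ₁ : LocallyIntegrableOn κ₁ (Set.Ioi 0))
    (hk₁ : LocallyIntegrableOn k₁ (Set.Ioi 0))
    (hSonin₁ : ∀ x > 0, lconv κ₁ k₁ x = 1)
    (hf₁ : ContinuousOn f₁ (Set.Ici 0))
    (f : ℝ → ℝ) (hf : ∀ x ≥ (0:ℝ), f x = x ^ p * f₁ x)
    (hfne : ∃ x > 0, f x ≠ 0)
    (a b : ℕ → ℝ) (ha0 : a 0 ≠ 0)
    (hra : ∃ r > (0:ℝ), Summable fun n : ℕ => |a n| * r ^ n)
    (hrb : ∃ r > (0:ℝ), Summable fun n : ℕ => |b n| * r ^ n)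
    (Sa Sb : ℝ → ℝ)
    (hSa : ∀ x > 0, Sa x = ∑' n : ℕ, a (n + 1) * convPow f (n + 1) x)
    (hSb : ∀ x > 0, Sb x = ∑' n : ℕ, b (n + 1) * convPow f (n + 1) x)
    (hSaU : TendstoLocallyUniformlyOn
      (fun N x => ∑ n ∈ Finset.range N, a (n + 1) * convPow f (n + 1) x) Sa
      Filter.atTop (Set.Ioi 0))
    (hSbU : TendstoLocallyUniformlyOn
      (fun N x => ∑ n ∈ Finset.range N, b (n + 1) * convPow f (n + 1) x) Sb
      Filter.atTop (Set.Ioi 0))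
    (κ k : ℝ → ℝ)
    (hκ : ∀ x > 0, κ x = a 0 * κ₁ x + ∫ t in (0:ℝ)..x, κ₁ (x - t) * Sa t)
    (hk : ∀ x > 0, k x = b 0 * k₁ x + ∫ t in (0:ℝ)..x, k₁ (x - t) * Sb t) :
    (∀ x > 0, lconv κ k x = 1) ↔
      (a 0 * b 0 = 1 ∧
       ∀ n : ℕ, 1 ≤ n → ∑ m ∈ Finset.range (n + 1), a m * b (n - m) = 0) := by
  have hfc : ContinuousOn f (Set.Ici 0) := by
    refine ContinuousOn.congr (f := fun x => x ^ p * f₁ x) ?_ hf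
    exact (Real.continuous_rpow_const hp.le).continuousOn.mul hf₁
  have hfb : LocBdd f := locBdd_of_continuousOn hfc
  have hfne' : ¬ ∀ᵐ x, 0 < x → f x = 0 := by
    intro h
    obtain ⟨x, hx, hfx⟩ := hfne
    refine hfx (Measure.eqOn_open_of_ae_eq (μ := volume) (U := Set.Ioi 0) (g := fun _ => (0:ℝ))
      ((ae_restrict_iff' measurableSet_Ioi).2 h) isOpen_Ioi
      (hfc.mono Set.Ioi_subset_Ici_self) continuousOn_const hx)
  have hκL : LocInt κ₁ := locInt_of_lconv_ne_zero hκ₁ hk₁ fun x hx => by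
    rw [hSonin₁ x hx]
    exact one_ne_zero
  have hkL : LocInt k₁ := locInt_of_lconv_ne_zero hk₁ hκ₁ fun x hx => by
    rw [lconv_comm, hSonin₁ x hx]
    exact one_ne_zero
  have hag := geomBdd_of_summable hra
  have hbg := geomBdd_of_summable hrb
  set c : ℕ → ℝ := fun n => ∑ q ∈ Finset.HasAntidiagonal.antidiagonal n, a q.1 * b q.2
  have hcg : GeomBdd c := hag.antidiagonal hbg
  have hcr : ∀ n, ∑ m ∈ Finset.range (n + 1), a m * b (n - m) = c n := fun n =>
    (Finset.Nat.sum_antidiagonal_eq_sum_range_succ (fun i j => a i * b j) n).symm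
  have hmain : ∀ x > 0, lconv κ k x = a 0 * b 0 + ∫ t in (0:ℝ)..x, convSeries f c t := by
    intro x hx
    have hκ' : ∀ t > 0, κ t = a 0 * κ₁ t + lconv κ₁ (convSeries f a) t := fun t ht => by
      rw [hκ t ht]
      exact congrArg _ (lconv_congr_right ht.le
        (Filter.Eventually.of_forall fun s hs => hSa s hs.1))
    have hk' : ∀ t > 0, k t = b 0 * k₁ t + lconv k₁ (convSeries f b) t := fun t ht => by
      rw [hk t ht]
      exact congrArg _ (lconv_congr_right ht.le
        (Filter.Eventually.of_forall fun s hs => hSb s hs.1))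
    rw [lconv_congr_left hx.le (Filter.Eventually.of_forall fun t ht => hκ' t ht.1),
      lconv_congr_right hx.le (Filter.Eventually.of_forall fun t ht => hk' t ht.1),
      lconv_sonin_perturbation hκL hkL hSonin₁ (hfb.locBdd_convSeries hag)
        (hfb.locBdd_convSeries hbg) hx]
    congr 1
    refine intervalIntegral.integral_congr_ae (Filter.Eventually.of_forall fun t ht => ?_)
    rw [Set.uIoc_of_le hx.le] at ht
    exact (convSeries_antidiagonal hfb hag hbg ht.1).symm
  simp_rw [hcr]
  constructor
  · intro h
    obtain ⟨h0, hae⟩ := (hfb.locBdd_convSeries hcg).eq_zero_of_const_add_integral_eq_zero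
      (γ := a 0 * b 0 - 1) fun x hx => by linarith [h x hx, hmain x hx]
    refine ⟨by linarith, fun n hn => ?_⟩
    obtain ⟨m, rfl⟩ := Nat.exists_eq_add_of_le' hn
    exact hcg.eq_zero_of_convSeries_ae_eq_zero hfb hfne' hae m
  · rintro ⟨h0, hcn⟩ x hx
    rw [hmain x hx, h0]
    simp [convSeries, hcn]
end

section
/- Let 0 < β < 1, α > 0 and λ ∈ ℝ. Then the Wright-function kernels κ(x) = x^{β−1} W_{α,β}(λ x^α) and k(x) = x^{−β} W_{α,1−β}(−λ x^α) form a pair of Sonin kernels: for all x > 0, ∫₀ˣ (x−ξ)^{β−1} W_{α,β}(λ (x−ξ)^α) · ξ^{−β} W_{α,1−β}(−λ ξ^α) dξ = 1. -/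
open MeasureTheory Real

/-- The Wright function `W_{α,β}(z) = Σₙ zⁿ/(n!·Γ(αn+β))`. -/
noncomputable def wright (α β z : ℝ) : ℝ :=
  ∑' n : ℕ, z ^ n / ((n.factorial : ℝ) * Real.Gamma (α * n + β))

/-- The Gamma function is bounded below by a positive constant on `(0, ∞)`. -/
lemma exists_pos_le_Gamma : ∃ c : ℝ, 0 < c ∧ ∀ y : ℝ, 0 < y → c ≤ Real.Gamma y := by
  have hcont : ContinuousOn Real.Gamma (Set.Icc 1 2) := fun y hy =>
    (Real.differentiableAt_Gamma fun m hm => by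
      have : (0 : ℝ) ≤ m := m.cast_nonneg
      linarith [hy.1]).continuousAt.continuousWithinAt
  obtain ⟨y₀, hy₀, hmin⟩ := isCompact_Icc.exists_isMinOn
    (Set.nonempty_Icc.2 (by norm_num : (1 : ℝ) ≤ 2)) hcont
  have hc2 : Real.Gamma y₀ ≤ 1 := by
    simpa using hmin (Set.right_mem_Icc.2 (by norm_num : (1 : ℝ) ≤ 2))
  have hge : ∀ y : ℝ, 1 ≤ y → Real.Gamma y₀ ≤ Real.Gamma y := by
    intro y hy
    rcases le_total y 2 with h | h
    · exact hmin ⟨hy, h⟩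
    · have := Real.Gamma_strictMonoOn_Ici.monotoneOn (Set.mem_Ici.2 le_rfl) (Set.mem_Ici.2 h) h
      rw [Real.Gamma_two] at this
      exact hc2.trans this
  refine ⟨Real.Gamma y₀, Real.Gamma_pos_of_pos (by linarith [hy₀.1]), fun y hy => ?_⟩
  rcases le_total 1 y with h | h
  · exact hge y h
  · have h1 := hge (y + 1) (by linarith)
    rw [Real.Gamma_add_one hy.ne'] at h1
    exact h1.trans (mul_le_of_le_one_left (Real.Gamma_pos_of_pos hy).le h)

/-- The Wright series converges absolutely. -/
lemma summable_norm_wright {α β : ℝ} (hα : 0 < α) (hβ : 0 < β) (z : ℝ) :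
    Summable fun n : ℕ => ‖z ^ n / ((n.factorial : ℝ) * Real.Gamma (α * n + β))‖ := by
  obtain ⟨c, hc, hΓ⟩ := exists_pos_le_Gamma
  refine Summable.of_nonneg_of_le (fun _ => norm_nonneg _) (fun n => ?_)
    ((Real.summable_pow_div_factorial |z|).mul_right c⁻¹)
  have hg := hΓ (α * n + β) (by positivity)
  have hf : (0 : ℝ) < n.factorial := by positivity
  rw [norm_div, norm_mul, norm_pow, Real.norm_eq_abs, Real.norm_eq_abs, Real.norm_eq_abs,
    abs_of_pos hf, abs_of_pos (hc.trans_le hg), div_mul_eq_div_mul_one_div, one_div]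
  gcongr

/-- The Beta integral on `[0, x]`. -/
lemma integral_sub_rpow_mul_rpow {u v x : ℝ} (hu : 0 < u) (hv : 0 < v) (hx : 0 < x) :
    ∫ ξ in (0 : ℝ)..x, (x - ξ) ^ (u - 1) * ξ ^ (v - 1) =
      x ^ (u + v - 1) * (Real.Gamma u * Real.Gamma v / Real.Gamma (u + v)) := by
  have h := Complex.betaIntegral_scaled (v : ℂ) (u : ℂ) hx
  rw [Complex.betaIntegral_eq_Gamma_mul_div _ _ (by simpa using hv) (by simpa using hu)] at h
  apply Complex.ofReal_injective
  rw [← intervalIntegral.integral_ofReal]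
  have hcongr : ∫ ξ in (0 : ℝ)..x, (((x - ξ) ^ (u - 1) * ξ ^ (v - 1) : ℝ) : ℂ) =
      ∫ ξ in (0 : ℝ)..x, (ξ : ℂ) ^ ((v : ℂ) - 1) * ((x : ℂ) - ξ) ^ ((u : ℂ) - 1) := by
    refine intervalIntegral.integral_congr fun ξ hξ => ?_
    rw [Set.uIcc_of_le hx.le] at hξ
    rw [Complex.ofReal_mul, Complex.ofReal_cpow (sub_nonneg.2 hξ.2), Complex.ofReal_cpow hξ.1]
    push_cast
    ring
  rw [hcongr, h, Complex.ofReal_mul, Complex.ofReal_cpow hx.le]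
  push_cast [← Complex.Gamma_ofReal]
  rw [add_comm (v : ℂ), mul_comm (Complex.Gamma v)]

lemma intervalIntegrable_sub_rpow_mul_rpow {u v x : ℝ} (hu : 0 < u) (hv : 0 < v) (hx : 0 < x) :
    IntervalIntegrable (fun ξ : ℝ => (x - ξ) ^ (u - 1) * ξ ^ (v - 1)) volume 0 x := by
  by_contra h
  have h0 := integral_sub_rpow_mul_rpow hu hv hx
  rw [intervalIntegral.integral_undef h] at h0
  have h1 := Real.Gamma_pos_of_pos hu
  have h2 := Real.Gamma_pos_of_pos hv
  have h3 := Real.Gamma_pos_of_pos (add_pos hu hv)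
  have h4 : 0 < x ^ (u + v - 1) * (Real.Gamma u * Real.Gamma v / Real.Gamma (u + v)) := by
    positivity
  exact h4.ne h0

/-- Summability of a bounded multiple of the double exponential series. -/
lemma summable_norm_exp_mul_exp {g : ℕ → ℝ} {C : ℝ} (hg : ∀ n, |g n| ≤ C) (a b : ℝ) :
    Summable fun p : ℕ × ℕ =>
      ‖a ^ p.1 / (p.1.factorial : ℝ) * (b ^ p.2 / (p.2.factorial : ℝ)) * g (p.1 + p.2)‖ := by
  have h := (Real.summable_pow_div_factorial a).norm.mul_norm
    (Real.summable_pow_div_factorial b).norm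
  refine Summable.of_nonneg_of_le (fun _ => norm_nonneg _) (fun p => ?_) (h.mul_right C)
  rw [norm_mul]
  simp only [norm_mul, Real.norm_eq_abs (g _)]
  gcongr
  exact hg _

/-- Summing `aⁿ(-a)ᵐ/(n! m!) g(n+m)` along antidiagonals leaves only `g 0`. -/
lemma tsum_exp_mul_exp_neg {g : ℕ → ℝ} {C : ℝ} (hg : ∀ n, |g n| ≤ C) (a : ℝ) :
    ∑' p : ℕ × ℕ, a ^ p.1 / (p.1.factorial : ℝ) * ((-a) ^ p.2 / (p.2.factorial : ℝ)) *
      g (p.1 + p.2) = g 0 := by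
  have hs := (summable_norm_exp_mul_exp hg a (-a)).of_norm
  rw [← Finset.HasAntidiagonal.sigmaAntidiagonalEquivProd.tsum_eq]
  rw [← Finset.HasAntidiagonal.sigmaAntidiagonalEquivProd.summable_iff] at hs
  refine (Summable.tsum_sigma' (fun n => (hasSum_fintype _).summable) hs).trans ?_
  have hinner : ∀ n : ℕ, ∑' q : Finset.HasAntidiagonal.antidiagonal n,
      a ^ q.1.1 / (q.1.1.factorial : ℝ) * ((-a) ^ q.1.2 / (q.1.2.factorial : ℝ)) *
        g (q.1.1 + q.1.2) = (a + -a) ^ n / (n.factorial : ℝ) * g n := by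
    intro n
    rw [Finset.tsum_subtype (Finset.HasAntidiagonal.antidiagonal n) fun q : ℕ × ℕ =>
      a ^ q.1 / (q.1.factorial : ℝ) * ((-a) ^ q.2 / (q.2.factorial : ℝ)) * g (q.1 + q.2),
      (Commute.all a (-a)).add_pow', Finset.sum_div, Finset.sum_mul]
    refine Finset.sum_congr rfl fun q hq => ?_
    obtain rfl := Finset.HasAntidiagonal.mem_antidiagonal.1 hq
    have hch := Nat.add_choose_mul_factorial_mul_factorial q.1 q.2
    rw [← Nat.choose_symm_add] at hch
    have hch' : ((q.1 + q.2).choose q.1 : ℝ) * q.1.factorial * q.2.factorial =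
      (q.1 + q.2).factorial := by exact_mod_cast hch
    have h1 : (q.1.factorial : ℝ) ≠ 0 := by positivity
    have h2 : (q.2.factorial : ℝ) ≠ 0 := by positivity
    have h3 : ((q.1 + q.2).choose q.1 : ℝ) ≠ 0 := by
      exact_mod_cast (Nat.choose_pos (Nat.le_add_right _ _)).ne'
    rw [nsmul_eq_mul, ← hch']
    field_simp
  refine (tsum_congr hinner).trans ?_
  rw [tsum_eq_single 0 fun n hn => by simp [hn]]
  simp

/-- The Wright-function kernels `x^{β-1}W_{α,β}(λxᵅ)` and `x^{-β}W_{α,1-β}(-λxᵅ)`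
form a pair of Sonin kernels. -/
theorem wright_kernels_sonin (α β lam : ℝ) (hβ0 : 0 < β) (hβ1 : β < 1) (hα : 0 < α)
    (x : ℝ) (hx : 0 < x) :
    ∫ ξ in (0:ℝ)..x, ((x - ξ) ^ (β - 1) * wright α β (lam * (x - ξ) ^ α)) *
      (ξ ^ (-β) * wright α (1 - β) (-(lam * ξ ^ α))) = 1 := by
  have hβ' : 0 < 1 - β := sub_pos.2 hβ1
  obtain ⟨c, hc, hΓ⟩ := exists_pos_le_Gamma
  set A : ℕ × ℕ → ℝ := fun p =>
    lam ^ p.1 / ((p.1.factorial : ℝ) * Real.Gamma (α * p.1 + β)) *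
      ((-lam) ^ p.2 / ((p.2.factorial : ℝ) * Real.Gamma (α * p.2 + (1 - β)))) with hA
  set F : ℕ × ℕ → ℝ → ℝ := fun p ξ =>
    A p * ((x - ξ) ^ (α * p.1 + β - 1) * ξ ^ (α * p.2 + (1 - β) - 1)) with hF
  set g : ℕ → ℝ := fun n => (Real.Gamma (α * n + 1))⁻¹ with hgdef
  have hg : ∀ n, |g n| ≤ c⁻¹ := by
    intro n
    have h := hΓ (α * n + 1) (by positivity)
    rw [hgdef, abs_of_pos (inv_pos.2 (hc.trans_le h))]
    gcongr
  have hbeta : ∀ p : ℕ × ℕ,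
      ∫ ξ in (0 : ℝ)..x, (x - ξ) ^ (α * p.1 + β - 1) * ξ ^ (α * p.2 + (1 - β) - 1) =
        (x ^ α) ^ p.1 * (x ^ α) ^ p.2 *
          (Real.Gamma (α * p.1 + β) * Real.Gamma (α * p.2 + (1 - β)) * g (p.1 + p.2)) := by
    intro p
    rw [integral_sub_rpow_mul_rpow (by positivity) (by positivity) hx, ← pow_add,
      ← Real.rpow_mul_natCast hx.le, hgdef, div_eq_mul_inv]
    push_cast
    congr 4 <;> ring_nf
  have hG1 : ∀ n : ℕ, 0 < Real.Gamma (α * n + β) := fun n =>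
    Real.Gamma_pos_of_pos (by positivity)
  have hG2 : ∀ n : ℕ, 0 < Real.Gamma (α * n + (1 - β)) := fun n =>
    Real.Gamma_pos_of_pos (by positivity)
  have hint : ∀ p, ∫ ξ in Set.Ioc 0 x, F p ξ =
      (lam * x ^ α) ^ p.1 / (p.1.factorial : ℝ) *
        ((-(lam * x ^ α)) ^ p.2 / (p.2.factorial : ℝ)) * g (p.1 + p.2) := by
    intro p
    rw [← intervalIntegral.integral_of_le hx.le, hF, intervalIntegral.integral_const_mul, hbeta,
      ← neg_mul, mul_pow, mul_pow, hA]
    have h1 := (hG1 p.1).ne'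
    have h2 := (hG2 p.2).ne'
    field_simp
  have hint_norm : ∀ p, ∫ ξ in Set.Ioc 0 x, ‖F p ξ‖ = ‖∫ ξ in Set.Ioc 0 x, F p ξ‖ := by
    intro p
    have hnn : ∀ ξ ∈ Set.Ioc 0 x,
        0 ≤ (x - ξ) ^ (α * p.1 + β - 1) * ξ ^ (α * p.2 + (1 - β) - 1) := fun ξ hξ =>
      mul_nonneg (Real.rpow_nonneg (sub_nonneg.2 hξ.2) _) (Real.rpow_nonneg hξ.1.le _)
    rw [hF, integral_const_mul, norm_mul, Real.norm_of_nonneg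
      (setIntegral_nonneg measurableSet_Ioc hnn), ← integral_const_mul]
    refine setIntegral_congr_fun measurableSet_Ioc fun ξ hξ => ?_
    simp only
    rw [norm_mul, Real.norm_of_nonneg (hnn ξ hξ)]
  have hintegrable : ∀ p, Integrable (F p) (volume.restrict (Set.Ioc 0 x)) := fun p =>
    ((intervalIntegrable_iff_integrableOn_Ioc_of_le hx.le).1
      (intervalIntegrable_sub_rpow_mul_rpow (by positivity) (by positivity) hx)).const_mul (A p)
  have hsum : Summable fun p => ∫ ξ in Set.Ioc 0 x, ‖F p ξ‖ := by
    simp only [hint_norm, hint]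
    exact summable_norm_exp_mul_exp hg _ _
  have hpoint : ∀ ξ ∈ Set.Ioo 0 x,
      ((x - ξ) ^ (β - 1) * wright α β (lam * (x - ξ) ^ α)) *
        (ξ ^ (-β) * wright α (1 - β) (-(lam * ξ ^ α))) = ∑' p, F p ξ := by
    intro ξ hξ
    have hxξ : 0 < x - ξ := sub_pos.2 hξ.2
    rw [mul_mul_mul_comm, wright, wright, tsum_mul_tsum_of_summable_norm
      (summable_norm_wright hα hβ0 _) (summable_norm_wright hα hβ' _), ← tsum_mul_left]
    refine tsum_congr fun p => ?_
    have e1 : (x - ξ) ^ (α * p.1 + β - 1) = (x - ξ) ^ (β - 1) * ((x - ξ) ^ α) ^ p.1 := by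
      rw [← Real.rpow_mul_natCast hxξ.le, ← Real.rpow_add hxξ]
      ring_nf
    have e2 : ξ ^ (α * p.2 + (1 - β) - 1) = ξ ^ (-β) * (ξ ^ α) ^ p.2 := by
      rw [← Real.rpow_mul_natCast hξ.1.le, ← Real.rpow_add hξ.1]
      ring_nf
    simp only [hF, hA]
    rw [e1, e2, ← neg_mul, mul_pow, mul_pow]
    ring
  rw [intervalIntegral.integral_of_le hx.le, integral_Ioc_eq_integral_Ioo,
    setIntegral_congr_fun measurableSet_Ioo hpoint, ← integral_Ioc_eq_integral_Ioo,
    ← integral_tsum_of_summable_integral_norm hintegrable hsum, tsum_congr hint,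
    tsum_exp_mul_exp_neg hg]
  simp [hgdef]
end

section
/- Let 0 < β < 1, γ ∈ ℝ and λ ∈ ℝ. Then the Kummer-function kernels κ(x) = (x^{β−1}/Γ(β)) · ₁F₁(γ; β; −λx) and k(x) = (x^{−β}/Γ(1−β)) · ₁F₁(−γ; 1−β; −λx) form a pair of Sonin kernels: for all x > 0, (κ * k)(x) = 1. -/
open MeasureTheory Real

/-- The Pochhammer symbol `(γ)ₙ = γ(γ+1)⋯(γ+n-1)`. -/
noncomputable def poch (γ : ℝ) (n : ℕ) : ℝ := ∏ i ∈ Finset.range n, (γ + i)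

/-- The Kummer confluent hypergeometric function `₁F₁(γ;β;z) = Σₙ (γ)ₙ/(β)ₙ · zⁿ/n!`. -/
noncomputable def kummer (γ β z : ℝ) : ℝ :=
  ∑' n : ℕ, poch γ n / poch β n * z ^ n / (n.factorial : ℝ)

open Filter Finset

lemma poch_zero (a : ℝ) : poch a 0 = 1 := by simp [poch]

lemma poch_succ (a : ℝ) (n : ℕ) : poch a (n + 1) = poch a n * (a + n) := by
  simp [poch, Finset.prod_range_succ]

lemma poch_pos {a : ℝ} (ha : 0 < a) (n : ℕ) : 0 < poch a n :=
  Finset.prod_pos fun i _ => by positivity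

lemma poch_one (n : ℕ) : poch 1 n = n.factorial := by
  induction n with
  | zero => simp [poch_zero]
  | succ n ih => rw [poch_succ, ih, Nat.factorial_succ]; push_cast; ring

lemma poch_zero_left {n : ℕ} (hn : n ≠ 0) : poch 0 n = 0 :=
  Finset.prod_eq_zero (Finset.mem_range.2 (Nat.pos_of_ne_zero hn)) (by simp)

lemma Gamma_add_nat_eq_poch_mul {a : ℝ} (ha : 0 < a) (n : ℕ) :
    Real.Gamma (a + n) = poch a n * Real.Gamma a := by
  induction n with
  | zero => simp [poch_zero]
  | succ n ih =>
    have h : a + n ≠ 0 := by positivity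
    rw [poch_succ, Nat.cast_succ, ← add_assoc, Real.Gamma_add_one h, ih]
    ring

/-- The Chu–Vandermonde identity. -/
lemma sum_antidiagonal_poch (a b : ℝ) (N : ℕ) :
    ∑ p ∈ antidiagonal N, poch a p.1 / p.1.factorial * (poch b p.2 / p.2.factorial) =
      poch (a + b) N / N.factorial := by
  induction N with
  | zero => simp [poch_zero]
  | succ N ih =>
    have step (c : ℝ) (n : ℕ) : ((n + 1 : ℕ) : ℝ) * (poch c (n + 1) / (n + 1).factorial) =
        (c + n) * (poch c n / n.factorial) := by
      rw [poch_succ, Nat.factorial_succ]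
      push_cast
      field_simp
    have hN : ((N + 1 : ℕ) : ℝ) ≠ 0 := by positivity
    apply mul_left_cancel₀ hN
    rw [step, ← ih, Finset.mul_sum, Finset.mul_sum]
    have split : ∑ p ∈ antidiagonal (N + 1),
          ((N + 1 : ℕ) : ℝ) * (poch a p.1 / p.1.factorial * (poch b p.2 / p.2.factorial)) =
        ∑ p ∈ antidiagonal (N + 1),
          (p.1 * (poch a p.1 / p.1.factorial)) * (poch b p.2 / p.2.factorial) +
        ∑ p ∈ antidiagonal (N + 1),
          (poch a p.1 / p.1.factorial) * (p.2 * (poch b p.2 / p.2.factorial)) := by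
      rw [← Finset.sum_add_distrib]
      refine Finset.sum_congr rfl fun p hp => ?_
      rw [← mem_antidiagonal.1 hp]
      push_cast
      ring
    rw [split, Finset.Nat.sum_antidiagonal_succ, Finset.Nat.sum_antidiagonal_succ']
    simp only [step]
    simp only [Nat.cast_zero, zero_mul, mul_zero, zero_add]
    rw [← Finset.sum_add_distrib]
    refine Finset.sum_congr rfl fun p hp => ?_
    rw [← mem_antidiagonal.1 hp]
    push_cast
    ring

lemma summable_norm_kummer (a : ℝ) {b : ℝ} (hb : 0 < b) (z : ℝ) :
    Summable fun n : ℕ => ‖poch a n / poch b n * z ^ n / (n.factorial : ℝ)‖ := by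
  refine summable_of_ratio_norm_eventually_le (r := 1 / 2) (by norm_num) ?_
  filter_upwards [eventually_ge_atTop ⌈|a|⌉₊, eventually_ge_atTop ⌈4 * |z|⌉₊] with n h₁ h₂
  have h₁ := Nat.ceil_le.1 h₁
  have h₂ := Nat.ceil_le.1 h₂
  have hn : (0 : ℝ) ≤ n := n.cast_nonneg
  have hp := poch_pos hb n
  have hratio : poch a (n + 1) / poch b (n + 1) * z ^ (n + 1) / ((n + 1).factorial : ℝ) =
      ((a + n) * z / ((b + n) * (n + 1))) * (poch a n / poch b n * z ^ n / n.factorial) := by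
    rw [poch_succ, poch_succ, Nat.factorial_succ, pow_succ]
    push_cast
    field_simp
  rw [norm_norm, norm_norm, hratio, norm_mul]
  refine mul_le_mul_of_nonneg_right ?_ (norm_nonneg _)
  have hd : 0 < (b + n) * ((n : ℝ) + 1) := by positivity
  rw [norm_div, norm_mul, Real.norm_of_nonneg hd.le, div_le_iff₀ hd, Real.norm_eq_abs,
    Real.norm_eq_abs]
  have h₃ : |a + n| ≤ 2 * n := by
    have := abs_add_le a n
    rw [Nat.abs_cast] at this
    linarith
  have h₄ : |a + n| * |z| ≤ 2 * n * (n / 4) :=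
    mul_le_mul h₃ (by linarith) (abs_nonneg _) (by positivity)
  nlinarith [mul_nonneg hb.le hn]

lemma integral_rpow_mul_rpow_sub {s t x : ℝ} (hs : 0 < s) (ht : 0 < t) (hx : 0 < x) :
    ∫ ξ in (0 : ℝ)..x, (x - ξ) ^ (s - 1) * ξ ^ (t - 1) =
      x ^ (s + t - 1) * (Real.Gamma s * Real.Gamma t / Real.Gamma (s + t)) := by
  have h := Complex.betaIntegral_scaled t s hx
  have hG := Complex.Gamma_mul_Gamma_eq_betaIntegral (s := t) (t := s) (by simpa) (by simpa)
  have hne : Real.Gamma (s + t) ≠ 0 := (Real.Gamma_pos_of_pos (add_pos hs ht)).ne'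
  have hB : Complex.betaIntegral t s =
      ((Real.Gamma s * Real.Gamma t / Real.Gamma (s + t) : ℝ) : ℂ) := by
    rw [← Complex.ofReal_add, Complex.Gamma_ofReal, Complex.Gamma_ofReal, Complex.Gamma_ofReal,
      add_comm t s] at hG
    push_cast
    rw [eq_div_iff (by exact_mod_cast hne), mul_comm, ← hG, mul_comm]
  have hl : ∫ ξ in (0 : ℝ)..x, (ξ : ℂ) ^ ((t : ℂ) - 1) * ((x : ℂ) - ξ) ^ ((s : ℂ) - 1) =
      ((∫ ξ in (0 : ℝ)..x, (x - ξ) ^ (s - 1) * ξ ^ (t - 1) : ℝ) : ℂ) := by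
    rw [← intervalIntegral.integral_ofReal]
    refine intervalIntegral.integral_congr fun ξ hξ => ?_
    rw [Set.uIcc_of_le hx.le] at hξ
    rw [Complex.ofReal_mul, Complex.ofReal_cpow (sub_nonneg.2 hξ.2), Complex.ofReal_cpow hξ.1]
    push_cast
    ring
  rw [hl, hB] at h
  rw [← Complex.ofReal_inj, h, Complex.ofReal_mul, Complex.ofReal_cpow hx.le]
  push_cast
  rw [add_comm (t : ℂ) s]

lemma intervalIntegrable_rpow_mul_rpow_sub {s t x : ℝ} (hs : 0 < s) (ht : 0 < t) (hx : 0 < x) :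
    IntervalIntegrable (fun ξ => (x - ξ) ^ (s - 1) * ξ ^ (t - 1)) volume 0 x := by
  by_contra h
  have h0 := integral_rpow_mul_rpow_sub hs ht hx
  rw [intervalIntegral.integral_undef h] at h0
  have h₁ := Real.Gamma_pos_of_pos hs
  have h₂ := Real.Gamma_pos_of_pos ht
  have h₃ := Real.Gamma_pos_of_pos (add_pos hs ht)
  have : 0 < x ^ (s + t - 1) * (Real.Gamma s * Real.Gamma t / Real.Gamma (s + t)) := by positivity
  exact this.ne h0

/-- Summation of a double series along antidiagonals. -/
lemma HasSum.sum_antidiagonal {f : ℕ × ℕ → ℝ} {S : ℝ} (h : HasSum f S) :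
    HasSum (fun N => ∑ p ∈ antidiagonal N, f p) S := by
  have h' := (Finset.HasAntidiagonal.sigmaAntidiagonalEquivProd.hasSum_iff).2 h
  refine h'.sigma fun N => ?_
  rw [← Finset.sum_coe_sort]
  exact hasSum_fintype _

/-- The coefficient of `(x - ξ) ^ (β + m - 1) * ξ ^ (n - β)` in the product of the two Kummer
kernels, at `p = (m, n)`. -/
noncomputable def kernelCoeff (β γ lam : ℝ) (p : ℕ × ℕ) : ℝ :=
  (poch γ p.1 / poch β p.1 * (-lam) ^ p.1 / p.1.factorial / Real.Gamma β) *
    (poch (-γ) p.2 / poch (1 - β) p.2 * (-lam) ^ p.2 / p.2.factorial / Real.Gamma (1 - β))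

lemma kernelCoeff_mul_integral {β x : ℝ} (γ lam : ℝ) (hβ0 : 0 < β) (hβ1 : β < 1) (hx : 0 < x)
    (p : ℕ × ℕ) :
    kernelCoeff β γ lam p *
        ∫ ξ in (0 : ℝ)..x, (x - ξ) ^ (β + p.1 - 1) * ξ ^ (1 - β + p.2 - 1) =
      (-(lam * x)) ^ (p.1 + p.2) / (p.1 + p.2).factorial *
        (poch γ p.1 / p.1.factorial * (poch (-γ) p.2 / p.2.factorial)) := by
  have h1 : 0 < 1 - β := sub_pos.2 hβ1
  have hp₁ := poch_pos hβ0 p.1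
  have hp₂ := poch_pos h1 p.2
  have hG₁ := Real.Gamma_pos_of_pos hβ0
  have hG₂ := Real.Gamma_pos_of_pos h1
  rw [integral_rpow_mul_rpow_sub (by positivity) (by positivity) hx,
    Gamma_add_nat_eq_poch_mul hβ0, Gamma_add_nat_eq_poch_mul h1,
    show β + p.1 + (1 - β + p.2) = ((p.1 + p.2 : ℕ) : ℝ) + 1 by push_cast; ring,
    Real.Gamma_nat_eq_factorial, add_sub_cancel_right, Real.rpow_natCast, kernelCoeff,
    ← neg_mul, mul_pow, pow_add (-lam)]
  field_simp

lemma summable_kernel_integrals (γ y : ℝ) :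
    Summable fun p : ℕ × ℕ => ‖y ^ (p.1 + p.2) / (p.1 + p.2).factorial *
        (poch γ p.1 / p.1.factorial * (poch (-γ) p.2 / p.2.factorial))‖ := by
  refine Summable.of_nonneg_of_le (fun _ => norm_nonneg _) (fun p => ?_)
    ((summable_norm_kummer γ one_pos y).mul_of_nonneg (summable_norm_kummer (-γ) one_pos y)
      (fun _ => norm_nonneg _) (fun _ => norm_nonneg _))
  rw [poch_one, poch_one, ← norm_mul]
  have hle : ((p.1.factorial * p.2.factorial : ℕ) : ℝ) ≤ (p.1 + p.2).factorial := by
    exact_mod_cast Nat.le_of_dvd (Nat.factorial_pos _)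
      (Nat.factorial_mul_factorial_dvd_factorial_add _ _)
  have hr : ((p.1.factorial * p.2.factorial : ℕ) : ℝ) / (p.1 + p.2).factorial ≤ 1 :=
    div_le_one_of_le₀ hle (by positivity)
  have heq : y ^ (p.1 + p.2) / (p.1 + p.2).factorial *
        (poch γ p.1 / p.1.factorial * (poch (-γ) p.2 / p.2.factorial)) =
      (((p.1.factorial * p.2.factorial : ℕ) : ℝ) / (p.1 + p.2).factorial) *
      (poch γ p.1 / p.1.factorial * y ^ p.1 / p.1.factorial *
        (poch (-γ) p.2 / p.2.factorial * y ^ p.2 / p.2.factorial)) := by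
    rw [pow_add]
    push_cast
    field_simp
  rw [heq, norm_mul, Real.norm_of_nonneg (by positivity)]
  exact mul_le_of_le_one_left (norm_nonneg _) hr

lemma kernel_mul_kernel_eq_tsum {β x ξ : ℝ} (γ lam : ℝ) (hβ0 : 0 < β) (hβ1 : β < 1)
    (h0 : 0 < ξ) (hlt : ξ < x) :
    ((x - ξ) ^ (β - 1) / Real.Gamma β * kummer γ β (-(lam * (x - ξ)))) *
      (ξ ^ (-β) / Real.Gamma (1 - β) * kummer (-γ) (1 - β) (-(lam * ξ))) =
    ∑' p : ℕ × ℕ, kernelCoeff β γ lam p *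
      ((x - ξ) ^ (β + p.1 - 1) * ξ ^ (1 - β + p.2 - 1)) := by
  have hsub : 0 < x - ξ := sub_pos.2 hlt
  rw [mul_mul_mul_comm, kummer, kummer,
    tsum_mul_tsum_of_summable_norm (summable_norm_kummer γ hβ0 _)
      (summable_norm_kummer (-γ) (sub_pos.2 hβ1) _), ← tsum_mul_left]
  refine tsum_congr fun p => ?_
  rw [show β + p.1 - 1 = (β - 1) + p.1 by ring, show 1 - β + p.2 - 1 = -β + p.2 by ring,
    Real.rpow_add_natCast hsub.ne', Real.rpow_add_natCast h0.ne', ← neg_mul, ← neg_mul,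
    mul_pow, mul_pow, kernelCoeff]
  ring

/-- The Kummer-function kernels `(x^{β-1}/Γ(β))·₁F₁(γ;β;-λx)` and
`(x^{-β}/Γ(1-β))·₁F₁(-γ;1-β;-λx)` form a pair of Sonin kernels. -/
theorem kummer_kernels_sonin (β γ lam : ℝ) (hβ0 : 0 < β) (hβ1 : β < 1)
    (x : ℝ) (hx : 0 < x) :
    ∫ ξ in (0:ℝ)..x, ((x - ξ) ^ (β - 1) / Real.Gamma β * kummer γ β (-(lam * (x - ξ)))) *
      (ξ ^ (-β) / Real.Gamma (1 - β) * kummer (-γ) (1 - β) (-(lam * ξ))) = 1 := by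
  have h1 : 0 < 1 - β := sub_pos.2 hβ1
  let G : ℕ × ℕ → ℝ → ℝ := fun p ξ => (x - ξ) ^ (β + p.1 - 1) * ξ ^ (1 - β + p.2 - 1)
  have hto (f : ℝ → ℝ) : ∫ ξ in (0 : ℝ)..x, f ξ = ∫ ξ in Set.Ioo 0 x, f ξ := by
    rw [intervalIntegral.integral_of_le hx.le, integral_Ioc_eq_integral_Ioo]
  have hint (p : ℕ × ℕ) : IntegrableOn (G p) (Set.Ioo 0 x) := by
    rw [← intervalIntegrable_iff_integrableOn_Ioo_of_le hx.le]
    exact intervalIntegrable_rpow_mul_rpow_sub (by positivity) (by positivity) hx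
  have hval (p : ℕ × ℕ) := kernelCoeff_mul_integral γ lam hβ0 hβ1 hx p
  have hnonneg (p : ℕ × ℕ) : ∀ ξ ∈ Set.Ioo 0 x, 0 ≤ G p ξ := fun ξ hξ =>
    mul_nonneg (Real.rpow_nonneg (sub_nonneg.2 hξ.2.le) _) (Real.rpow_nonneg hξ.1.le _)
  have hnorm (p : ℕ × ℕ) : ∫ ξ in Set.Ioo 0 x, ‖kernelCoeff β γ lam p * G p ξ‖ =
      ‖(-(lam * x)) ^ (p.1 + p.2) / (p.1 + p.2).factorial *
        (poch γ p.1 / p.1.factorial * (poch (-γ) p.2 / p.2.factorial))‖ := by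
    rw [← hval, hto, norm_mul,
      Real.norm_of_nonneg (setIntegral_nonneg measurableSet_Ioo (hnonneg p)), ← integral_const_mul]
    refine setIntegral_congr_fun measurableSet_Ioo fun ξ hξ => ?_
    rw [norm_mul, Real.norm_of_nonneg (hnonneg p ξ hξ)]
  have hsum := hasSum_integral_of_summable_integral_norm
    (F := fun p ξ => kernelCoeff β γ lam p * G p ξ) (fun p => (hint p).const_mul _)
    (by simp only [hnorm]; exact summable_kernel_integrals γ _)
  have hdiag := hsum.sum_antidiagonal
  rw [hto, setIntegral_congr_fun measurableSet_Ioo fun ξ hξ =>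
    kernel_mul_kernel_eq_tsum γ lam hβ0 hβ1 hξ.1 hξ.2]
  refine hdiag.unique ?_
  convert hasSum_ite_eq (0 : ℕ) (1 : ℝ) using 2 with N
  have hterm : ∀ p ∈ antidiagonal N, ∫ ξ in Set.Ioo 0 x, kernelCoeff β γ lam p * G p ξ =
      (-(lam * x)) ^ N / N.factorial *
        (poch γ p.1 / p.1.factorial * (poch (-γ) p.2 / p.2.factorial)) := fun p hp => by
    rw [integral_const_mul, ← hto, hval, mem_antidiagonal.1 hp]
  rw [Finset.sum_congr rfl hterm, ← Finset.mul_sum, sum_antidiagonal_poch, add_neg_cancel]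
  split_ifs with hN
  · simp [hN, poch_zero]
  · simp [poch_zero_left hN]
end

section
/- Let α > 0, β > 0, λ ∈ ℝ and p > 0. Then the Laplace transform of the Wright-type kernel x^{β−1} W_{α,β}(λ x^α) equals p^{−β} exp(λ p^{−α}): ∫₀^∞ e^{−px} x^{β−1} W_{α,β}(λ x^α) dx = p^{−β} e^{λ p^{−α}}. -/
open MeasureTheory Real

/-- The Laplace transform of a Wright series coefficient times its power of `x`. -/
lemma laplace_wright_term {α β p : ℝ} (hα : 0 < α) (hβ : 0 < β) (hp : 0 < p) (lam : ℝ) (n : ℕ) :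
    ∫ x in Set.Ioi (0:ℝ), lam ^ n / ((n.factorial : ℝ) * Real.Gamma (α * n + β)) *
        (x ^ (α * n + β - 1) * Real.exp (-(p * x)))
      = p ^ (-β) * ((lam * p ^ (-α)) ^ n / n.factorial) := by
  have hs : 0 < α * n + β := by positivity
  have hΓ : Real.Gamma (α * n + β) ≠ 0 := (Real.Gamma_pos_of_pos hs).ne'
  have hpow : (1 / p) ^ (α * n + β) = p ^ (-β) * (p ^ (-α)) ^ n := by
    rw [one_div, Real.inv_rpow hp.le, ← Real.rpow_neg hp.le, ← Real.rpow_natCast,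
      ← Real.rpow_mul hp.le, ← Real.rpow_add hp]
    ring_nf
  rw [integral_const_mul, Real.integral_rpow_mul_exp_neg_mul_Ioi hs hp, hpow, mul_pow]
  field_simp

/-- The kernel expands into its Wright series termwise. -/
lemma exp_mul_rpow_mul_wright {x : ℝ} (hx : 0 < x) (α β lam p : ℝ) :
    Real.exp (-(p * x)) * (x ^ (β - 1) * wright α β (lam * x ^ α))
      = ∑' n : ℕ, lam ^ n / ((n.factorial : ℝ) * Real.Gamma (α * n + β)) *
        (x ^ (α * n + β - 1) * Real.exp (-(p * x))) := by
  rw [wright, ← mul_assoc, ← tsum_mul_left]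
  refine tsum_congr fun n => ?_
  rw [add_sub_assoc, Real.rpow_add hx, Real.rpow_mul hx.le, Real.rpow_natCast, mul_pow]
  ring

/-- The Laplace transform of the Wright-type kernel `x^{β-1}W_{α,β}(λxᵅ)` is
`p^{-β}·exp(λp^{-α})`. -/
theorem laplace_wright_kernel (α β lam p : ℝ) (hα : 0 < α) (hβ : 0 < β) (hp : 0 < p) :
    ∫ x in Set.Ioi (0:ℝ), Real.exp (-(p * x)) * (x ^ (β - 1) * wright α β (lam * x ^ α))
      = p ^ (-β) * Real.exp (lam * p ^ (-α)) := by
  have hs (n : ℕ) : 0 < α * n + β := by positivity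
  have hΓ (n : ℕ) : 0 < Real.Gamma (α * n + β) := Real.Gamma_pos_of_pos (hs n)
  rw [setIntegral_congr_fun measurableSet_Ioi fun x hx => exp_mul_rpow_mul_wright hx α β lam p]
  have hsum := hasSum_integral_of_summable_integral_norm (μ := volume.restrict (Set.Ioi (0:ℝ)))
    (F := fun (n : ℕ) (x : ℝ) => lam ^ n / ((n.factorial : ℝ) * Real.Gamma (α * n + β)) *
        (x ^ (α * n + β - 1) * Real.exp (-(p * x)))) ?_ ?_
  · simp only [laplace_wright_term hα hβ hp] at hsum
    refine hsum.unique (HasSum.mul_left _ ?_)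
    rw [Real.exp_eq_exp_ℝ]
    exact NormedSpace.expSeries_div_hasSum_exp (lam * p ^ (-α))
  · intro n
    refine Integrable.const_mul (.of_integral_ne_zero ?_) _
    rw [Real.integral_rpow_mul_exp_neg_mul_Ioi (hs n) hp]
    have := hΓ n
    positivity
  · have hnorm (n : ℕ) : ∫ x in Set.Ioi (0:ℝ),
        ‖lam ^ n / ((n.factorial : ℝ) * Real.Gamma (α * n + β)) *
          (x ^ (α * n + β - 1) * Real.exp (-(p * x)))‖
        = p ^ (-β) * ((|lam| * p ^ (-α)) ^ n / n.factorial) := by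
      rw [← laplace_wright_term hα hβ hp]
      refine setIntegral_congr_fun measurableSet_Ioi fun x hx => ?_
      have hx : 0 < x := hx
      simp only [norm_mul, norm_div, norm_pow, Real.norm_eq_abs, Nat.abs_cast,
        abs_of_pos (hΓ n), Real.abs_exp, abs_of_pos (Real.rpow_pos_of_pos hx _)]
    simp only [hnorm]
    exact (Real.summable_pow_div_factorial _).mul_left _
end

section
/- Let α > 0, β > 0, γ ∈ ℝ, λ ∈ ℝ and p > 0 with |λ| p^{−α} < 1. Then the Laplace transform of the Prabhakar kernel x^{β−1} E^γ_{α,β}(−λ x^α) equals p^{αγ−β} (p^α + λ)^{−γ}: ∫₀^∞ e^{−px} x^{β−1} E^γ_{α,β}(−λ x^α) dx = p^{αγ−β} (p^α + λ)^{−γ}. -/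
open MeasureTheory Real

/-- The three-parameter Mittag-Leffler (Prabhakar) function
`E^γ_{α,β}(z) = Σₙ (γ)ₙ/(n!·Γ(αn+β))·zⁿ`. -/
noncomputable def prabhakar (γ α β z : ℝ) : ℝ :=
  ∑' n : ℕ, poch γ n / ((n.factorial : ℝ) * Real.Gamma (α * n + β)) * z ^ n

lemma poch_eq_ascPochhammer_eval (γ : ℝ) (n : ℕ) : poch γ n = (ascPochhammer ℝ n).eval γ := by
  induction n with
  | zero => simp [poch]
  | succ n ih => rw [ascPochhammer_succ_eval, ← ih, poch, poch, Finset.prod_range_succ]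

lemma choose_eq_poch_div_factorial (γ : ℝ) (n : ℕ) :
    Ring.choose (γ + n - 1) n = poch γ n / n.factorial := by
  rw [poch_eq_ascPochhammer_eval, ← Polynomial.ascPochhammer_smeval_eq_eval,
    ← Ring.factorial_nsmul_multichoose_eq_ascPochhammer, ← Ring.multichoose_eq, nsmul_eq_mul]
  field_simp

/-- The binomial series `Σₙ (γ)ₙ/n!·yⁿ = (1-y)^{-γ}` for `|y| < 1`. -/
lemma hasSum_poch_div_factorial_mul_pow (γ : ℝ) {y : ℝ} (hy : |y| < 1) :
    HasSum (fun n : ℕ ↦ poch γ n / n.factorial * y ^ n) ((1 - y) ^ (-γ)) := by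
  have hball : y ∈ Metric.eball (0 : ℝ) 1 := by
    rw [← ENNReal.ofReal_one, Metric.eball_ofReal]
    simpa using hy
  have h := (one_div_one_sub_rpow_hasFPowerSeriesOnBall_zero γ).hasSum hball
  rw [zero_add, one_div, ← rpow_neg (by linarith [le_abs_self y])] at h
  simpa [FormalMultilinearSeries.ofScalars_apply_eq, choose_eq_poch_div_factorial, mul_comm] using h

/-- The `n`-th term of the Laplace integrand of the Prabhakar kernel, as a multiple of a Gamma
integrand. -/
lemma laplace_prabhakar_term (α β lam p a : ℝ) (n : ℕ) {x : ℝ} (hx : 0 < x) :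
    exp (-(p * x)) * (x ^ (β - 1) * (a * (-(lam * x ^ α)) ^ n))
      = a * (-lam) ^ n * (x ^ (α * n + β - 1) * exp (-(p * x))) := by
  rw [add_sub_assoc, rpow_add hx, rpow_mul hx.le, rpow_natCast, ← neg_mul lam, mul_pow]
  ring

/-- The Laplace transform of the Prabhakar kernel `x^{β-1}E^γ_{α,β}(-λxᵅ)` is
`p^{αγ-β}·(pᵅ+λ)^{-γ}`. -/
theorem laplace_prabhakar_kernel (α β γ lam p : ℝ) (hα : 0 < α) (hβ : 0 < β) (hp : 0 < p)
    (hlam : |lam| * p ^ (-α) < 1) :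
    ∫ x in Set.Ioi (0:ℝ), Real.exp (-(p * x)) * (x ^ (β - 1) * prabhakar γ α β (-(lam * x ^ α)))
      = p ^ (α * γ - β) * (p ^ α + lam) ^ (-γ) := by
  set c : ℕ → ℝ := fun n ↦ poch γ n / (n.factorial * Gamma (α * n + β)) * (-lam) ^ n with hc
  set F : ℕ → ℝ → ℝ := fun n x ↦ c n * (x ^ (α * n + β - 1) * exp (-(p * x))) with hF
  have hs (n : ℕ) : 0 < α * n + β := by positivity
  have hy : |-(lam * p ^ (-α))| < 1 := by
    rwa [abs_neg, abs_mul, abs_of_pos (rpow_pos_of_pos hp _)]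
  have hterm (n : ℕ) : c n * ((1 / p) ^ (α * n + β) * Gamma (α * n + β))
      = p ^ (-β) * (poch γ n / n.factorial * (-(lam * p ^ (-α))) ^ n) := by
    have hΓ := (Gamma_pos_of_pos (hs n)).ne'
    have hpow : (1 / p) ^ (α * n + β) = (p ^ (-α)) ^ n * p ^ (-β) := by
      rw [one_div, inv_rpow hp.le, ← rpow_neg hp.le, neg_add, ← neg_mul, rpow_add hp,
        rpow_mul hp.le, rpow_natCast]
    rw [hpow, ← neg_mul, mul_pow, hc]
    field_simp
  have hint (n : ℕ) : IntegrableOn (F n) (Set.Ioi 0) := by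
    have h := integrableOn_rpow_mul_exp_neg_mul_rpow
      (show -1 < α * n + β - 1 by linarith [hs n]) one_pos hp
    simp only [rpow_one, neg_mul] at h
    exact h.const_mul _
  have hsum := hasSum_poch_div_factorial_mul_pow γ hy
  have hnorm (n : ℕ) : ∫ x in Set.Ioi 0, ‖F n x‖
      = |p ^ (-β) * (poch γ n / n.factorial * (-(lam * p ^ (-α))) ^ n)| := by
    have hcongr : ∫ x in Set.Ioi 0, ‖F n x‖
        = ∫ x in Set.Ioi 0, |c n| * (x ^ (α * n + β - 1) * exp (-(p * x))) := by
      refine setIntegral_congr_fun measurableSet_Ioi fun x (hx : 0 < x) ↦ ?_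
      simp only [hF, norm_mul, norm_eq_abs, abs_of_pos (rpow_pos_of_pos hx _), abs_exp]
    rw [hcongr, integral_const_mul, integral_rpow_mul_exp_neg_mul_Ioi (hs n) hp, ← hterm,
      abs_mul (c n), abs_of_pos (mul_pos (rpow_pos_of_pos (one_div_pos.2 hp) _) (Gamma_pos_of_pos (hs n)))]
  have hHasSum := hasSum_integral_of_summable_integral_norm hint
    (by simpa only [hnorm] using (hsum.summable.mul_left _).abs)
  simp only [hF, integral_const_mul, integral_rpow_mul_exp_neg_mul_Ioi (hs _) hp, hterm] at hHasSum
  have hseries : ∫ x in Set.Ioi (0:ℝ),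
      exp (-(p * x)) * (x ^ (β - 1) * prabhakar γ α β (-(lam * x ^ α)))
      = ∫ x in Set.Ioi (0:ℝ), ∑' n, F n x := by
    refine setIntegral_congr_fun measurableSet_Ioi fun x (hx : 0 < x) ↦ ?_
    simp only [prabhakar, ← tsum_mul_left, laplace_prabhakar_term _ _ _ _ _ _ hx, hF, hc]
  have hpos : 0 < 1 + lam * p ^ (-α) := by linarith [le_abs_self (-(lam * p ^ (-α)))]
  have hfactor : p ^ α + lam = p ^ α * (1 + lam * p ^ (-α)) := by
    rw [mul_add, mul_left_comm, ← rpow_add hp, add_neg_cancel, rpow_zero]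
    ring
  rw [hseries, hHasSum.unique (hsum.mul_left _), sub_neg_eq_add, hfactor,
    mul_rpow (rpow_nonneg hp.le _) hpos.le, ← rpow_mul hp.le, ← mul_assoc, ← rpow_add hp]
  congr 2
  ring
end
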